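/- arXiv:1103.2992 — 2 statements merged into one kernel-verified Lean document; each statement's English description precedes it below -/
import Mathlib

section
/- Let F be the free group of rank r ≥ 2 with basis {a_1, ..., a_r}, let 1 ≤ l ≤ r-1, and let F̂ be the subgroup generated by {a_1, ..., a_l}. Let F'' = (F')' denote the second derived subgroup of F, so that F/F'' is the free metabelian group of rank r, and similarly F̂'' in F̂. If S = {x_1, ..., x_k} ⊆ F̂ is such that the image of S in F/F'' extends to a generating set of F/F'' of cardinality r (equivalently, to a basis), then the image of S in F̂/F̂'' extends to a generating set of F̂/F̂'' of cardinality l. -/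
/-- The subgroup of the free group on `Fin r` generated by the first `l` generators. -/
def hatSubgroup (r l : ℕ) : Subgroup (FreeGroup (Fin r)) :=
  Subgroup.closure (FreeGroup.of '' {i : Fin r | (i : ℕ) < l})

instance (G : Type*) [Group G] (n : ℕ) : (derivedSeries G n).Normal :=
  derivedSeries_normal G n

/-- The free metabelian quotient `G/G''` where `G'' = (G')'` is the second derived
subgroup, i.e. `derivedSeries G 2`. -/
abbrev MetabelianQuot (G : Type*) [Group G] := G ⧸ derivedSeries G 2


set_option linter.unusedSectionVars false

namespace FM
open Matrix

variable {R S : Type*} [CommRing R] [CommRing S]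
variable {ι κ : Type*} [Fintype ι] [Fintype κ]

/-- Equivalence of column vectors under the general linear group. -/
def UEquiv [DecidableEq ι] (u v : ι → R) : Prop := ∃ V : Matrix ι ι R, IsUnit V ∧ V *ᵥ u = v

/-- Unimodular vectors. -/
def Unimod (u : ι → R) : Prop := ∃ c : ι → R, ∑ i, c i * u i = 1

theorem Unimod.map (f : R →+* S) {u : ι → R} (h : Unimod u) : Unimod (fun i => f (u i)) := by
  obtain ⟨c, hc⟩ := h
  refine ⟨fun i => f (c i), ?_⟩
  simp only [← map_mul, ← map_sum, hc, map_one]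

theorem unimod_iff {u : ι → R} : Unimod u ↔ Ideal.span (Set.range u) = ⊤ := by
  rw [Ideal.eq_top_iff_one, Ideal.mem_span_range_iff_exists_fun]
  rfl

variable [DecidableEq ι] [DecidableEq κ]

theorem UEquiv.refl (u : ι → R) : UEquiv u u := ⟨1, isUnit_one, by simp⟩

theorem UEquiv.trans {u v w : ι → R} (h : UEquiv u v) (h' : UEquiv v w) : UEquiv u w := by
  obtain ⟨V, hV, rfl⟩ := h
  obtain ⟨W, hW, rfl⟩ := h'
  exact ⟨W * V, hW.mul hV, by simp⟩

theorem UEquiv.symm {u v : ι → R} (h : UEquiv u v) : UEquiv v u := by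
  obtain ⟨V, ⟨W, rfl⟩, rfl⟩ := h
  exact ⟨(W⁻¹ : (Matrix ι ι R)ˣ), Units.isUnit _, by rw [mulVec_mulVec]; simp⟩

theorem UEquiv.map (f : R →+* S) {u v : ι → R} (h : UEquiv u v) :
    UEquiv (fun i => f (u i)) (fun i => f (v i)) := by
  obtain ⟨V, hV, rfl⟩ := h
  refine ⟨f.mapMatrix V, hV.map f.mapMatrix, ?_⟩
  ext i
  simp [mulVec, dotProduct]

theorem UEquiv.reindex (e : κ ≃ ι) {u v : ι → R} (h : UEquiv u v) :
    UEquiv (u ∘ e) (v ∘ e) := by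
  obtain ⟨V, hV, rfl⟩ := h
  refine ⟨V.submatrix e e, ?_, ?_⟩
  · rw [Matrix.isUnit_iff_isUnit_det] at hV ⊢
    rwa [Matrix.det_submatrix_equiv_self]
  · ext i
    simp only [mulVec, dotProduct, submatrix_apply, Function.comp]
    exact e.sum_comp (fun j => V (e i) j * u j)

theorem UEquiv.of_reindex (e : κ ≃ ι) {u v : ι → R} (h : UEquiv (u ∘ e) (v ∘ e)) :
    UEquiv u v := by
  have := h.reindex e.symm
  simpa [Function.comp_assoc] using this

theorem UEquiv.sum {u u' : ι → R} {v v' : κ → R} (h : UEquiv u u') (h' : UEquiv v v') :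
    UEquiv (Sum.elim u v) (Sum.elim u' v') := by
  obtain ⟨V, hV, rfl⟩ := h
  obtain ⟨W, hW, rfl⟩ := h'
  refine ⟨fromBlocks V 0 0 W, ?_, ?_⟩
  · rw [Matrix.isUnit_iff_isUnit_det] at hV hW ⊢
    rw [det_fromBlocks_zero₂₁]
    exact hV.mul hW
  · rw [fromBlocks_mulVec]
    simp

/-- Elementary operations: add combinations of entries in `P` to entries outside of `P`. -/
theorem UEquiv.elem (P : Set ι) {u v : ι → R} (h1 : ∀ i ∈ P, v i = u i)
    (h2 : ∀ i ∉ P, v i - u i ∈ Ideal.span (u '' P)) : UEquiv u v := by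
  classical
  have key : ∀ i, ∃ c : ι → R, (∀ j, j ∉ P → c j = 0) ∧ (i ∈ P → c = 0) ∧
      v i - u i = ∑ j, c j * u j := by
    intro i
    by_cases hi : i ∈ P
    · exact ⟨0, by simp, by simp, by simp [h1 i hi]⟩
    · have := h2 i hi
      have hs : u '' P = Set.range (fun j : P => u j) := by
        ext x; simp
      rw [hs, Ideal.mem_span_range_iff_exists_fun] at this
      obtain ⟨c, hc⟩ := this
      refine ⟨fun j => if hj : j ∈ P then c ⟨j, hj⟩ else 0, ?_, fun h => absurd h hi, ?_⟩
      · intro j hj; simp [hj]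
      · rw [← hc]
        refine Fintype.sum_of_injective (Subtype.val : P → ι) Subtype.val_injective _ _ ?_ ?_
        · intro j hj
          have : j ∉ P := by simpa using hj
          simp [this]
        · intro j; simp
  choose c hc1 hc2 hc3 using key
  let N : Matrix ι ι R := Matrix.of c
  have hN : N * N = 0 := by
    ext i j
    rw [mul_apply]
    refine Finset.sum_eq_zero fun k _ => ?_
    by_cases hk : k ∈ P
    · have : N k j = 0 := by simp [N, hc2 k hk]
      simp [this]
    · have : N i k = 0 := by simp [N, hc1 i k hk]
      simp [this]
  refine ⟨1 + N, ?_, ?_⟩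
  · refine ⟨⟨1 + N, 1 - N, ?_, ?_⟩, rfl⟩
    · rw [add_mul, mul_sub, mul_sub, hN]; simp
    · rw [sub_mul, mul_add, mul_add, hN]; simp
  · rw [add_mulVec, one_mulVec]
    ext i
    have := hc3 i
    simp only [Pi.add_apply, mulVec, dotProduct, N, Matrix.of_apply, ← this]
    ring

theorem UEquiv.span_le {u v : ι → R} (h : UEquiv u v) :
    Ideal.span (Set.range v) ≤ Ideal.span (Set.range u) := by
  obtain ⟨V, -, rfl⟩ := h
  rw [Ideal.span_le]
  rintro _ ⟨i, rfl⟩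
  exact Ideal.sum_mem _ fun j _ => Ideal.mul_mem_left _ _ (Ideal.subset_span ⟨j, rfl⟩)

theorem UEquiv.span_eq {u v : ι → R} (h : UEquiv u v) :
    Ideal.span (Set.range u) = Ideal.span (Set.range v) :=
  le_antisymm h.symm.span_le h.span_le

theorem UEquiv.unimod {u v : ι → R} (h : UEquiv u v) (hu : Unimod u) : Unimod v := by
  rw [unimod_iff] at *
  rw [← h.span_eq, hu]

theorem Unimod.reindex (e : κ ≃ ι) {u : ι → R} (h : Unimod u) : Unimod (u ∘ e) := by
  obtain ⟨c, hc⟩ := h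
  exact ⟨c ∘ e, by rw [← hc]; exact e.sum_comp (fun j => c j * u j)⟩

/-- If one entry is a unit, the vector is equivalent to any standard vector. -/
theorem UEquiv.of_isUnit {u : ι → R} (i : ι) (h : IsUnit (u i)) :
    UEquiv u (Pi.single i 1) := by
  have h1 : UEquiv u (Pi.single i (u i)) := by
    refine UEquiv.elem {i} (by rintro j rfl; simp) ?_
    intro j hj
    have : Ideal.span (u '' {i}) = ⊤ := by
      rw [Set.image_singleton, Ideal.span_singleton_eq_top]; exact h
    rw [this]; trivial
  refine h1.trans ?_
  obtain ⟨a, ha⟩ := h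
  refine ⟨Matrix.diagonal (fun _ => ((a⁻¹ : Rˣ) : R)), ?_, ?_⟩
  · rw [Matrix.isUnit_iff_isUnit_det, det_diagonal]
    simpa using (a⁻¹).isUnit.pow _
  · ext j
    rw [mulVec_diagonal]
    by_cases hj : j = i
    · subst hj; simp [← ha]
    · simp [hj]

theorem UEquiv.single_single (i j : ι) : UEquiv (Pi.single i (1:R)) (Pi.single j 1) := by
  have := (UEquiv.refl (Pi.single i (1:R))).reindex (Equiv.swap i j)
  by_cases h : i = j
  · subst h; exact UEquiv.refl _
  have h1 : UEquiv (Pi.single i (1:R)) (Pi.single i 1 + Pi.single j 1) := by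
    refine UEquiv.elem {i} (by rintro k rfl; simp [h]) ?_
    intro k hk
    have : Ideal.span ((Pi.single i (1:R) : ι → R) '' {i}) = ⊤ := by
      rw [Set.image_singleton, Ideal.span_singleton_eq_top]; simp
    rw [this]; trivial
  refine h1.trans ?_
  apply UEquiv.of_isUnit
  simp [Ne.symm h]

/-- Hermite rings: unimodular vectors are completable. -/
def Herm (R : Type) [CommRing R] : Prop :=
  ∀ (ι : Type) [Fintype ι] [DecidableEq ι] (i : ι) (u : ι → R), Unimod u →
    UEquiv u (Pi.single i 1)

end FM

set_option linter.unusedSectionVars false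

namespace FM
open Matrix

/-- Product trick. -/
theorem exists_prod_trick {R : Type*} [CommRing R] [IsDomain R] [UniqueFactorizationMonoid R]
    (a b : R) (ha : a ≠ 0) :
    ∃ y : R, ∀ p : R, Prime p → p ∣ a → (p ∣ y ↔ ¬ p ∣ b) := by
  classical
  let s := (UniqueFactorizationMonoid.factors a).filter (fun q => ¬ q ∣ b)
  refine ⟨s.prod, fun p hp hpa => ⟨fun h => ?_, fun h => ?_⟩⟩
  · obtain ⟨q, hq, hpq⟩ := hp.exists_mem_multiset_dvd h
    rw [Multiset.mem_filter] at hq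
    have hass : Associated p q :=
      (hp.irreducible.associated_of_dvd
        (UniqueFactorizationMonoid.irreducible_of_factor q hq.1) hpq)
    rw [hass.dvd_iff_dvd_left]
    exact hq.2
  · obtain ⟨q, hq, hpq⟩ := UniqueFactorizationMonoid.exists_mem_factors_of_dvd ha hp.irreducible hpa
    have : q ∈ s := Multiset.mem_filter.2 ⟨hq, by rwa [← hpq.dvd_iff_dvd_left]⟩
    exact hpq.dvd.trans (Multiset.dvd_prod this)

/-- Over a PID. -/
theorem exists_coprime {R : Type*} [CommRing R] [IsDomain R] [IsPrincipalIdealRing R]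
    {κ : Type*} [Fintype κ] (f₁ f₂ : R) (f : κ → R) (h : f₁ ≠ 0)
    (hu : Unimod (Sum.elim ![f₁, f₂] f)) :
    ∃ y : κ → R, IsCoprime f₁ (f₂ + ∑ i, y i * f i) := by
  obtain ⟨t, ht⟩ := exists_prod_trick f₁ f₂ h
  obtain ⟨G, hG⟩ := (IsPrincipalIdealRing.principal (Ideal.span (Set.range f))).principal
  have hG1 : G ∈ Ideal.span (Set.range f) := by rw [hG]; exact Submodule.mem_span_singleton_self G
  rw [Ideal.mem_span_range_iff_exists_fun] at hG1
  obtain ⟨z, hz⟩ := hG1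
  refine ⟨fun i => t * z i, ?_⟩
  have e : ∑ i, t * z i * f i = t * G := by
    rw [← hz, Finset.mul_sum]; simp only [mul_assoc]
  rw [e]
  refine isCoprime_of_prime_dvd (fun h' => h h'.1) ?_
  intro p hp h1 h2
  by_cases hpb : p ∣ f₂
  · have h3 : p ∣ t * G := (dvd_add_right hpb).1 h2
    have h4 : p ∣ G := (hp.dvd_or_dvd h3).resolve_left (fun h5 => (ht p hp h1).1 h5 hpb)
    apply hp.not_isUnit
    obtain ⟨c, hc⟩ := hu
    rw [isUnit_iff_dvd_one, ← hc]
    refine Finset.dvd_sum ?_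
    rintro (i | i) _
    · fin_cases i
      · exact h1.mul_left _
      · exact hpb.mul_left _
    · have : f i ∈ Ideal.span (Set.range f) := Ideal.subset_span ⟨i, rfl⟩
      rw [hG] at this
      have := Ideal.mem_span_singleton.1 this
      exact (h4.trans this).mul_left _
  · have := (ht p hp h1).2 hpb
    exact hpb ((dvd_add_left (this.mul_right G)).1 h2)

open Polynomial in
/-- Local step. -/
theorem exists_local {B : Type*} [CommRing B] (m : Ideal B) (hm : m.IsMaximal)
    {κ : Type*} [Fintype κ] (f₁ f₂ : B[X]) (f : κ → B[X]) (h : f₁.Monic)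
    (hu : Unimod (Sum.elim ![f₁, f₂] f)) :
    ∃ (y : κ → B[X]) (r : B) (g₁ g₂ : B[X]), r ∉ m ∧
      C r = f₁ * g₁ + (f₂ + ∑ i, y i * f i) * g₂ := by
  classical
  let _ : Field (B ⧸ m) := Ideal.Quotient.field m
  let φ : B[X] →+* (B ⧸ m)[X] := Polynomial.mapRingHom (Ideal.Quotient.mk m)
  have hφ : Function.Surjective φ := Polynomial.map_surjective _ Ideal.Quotient.mk_surjective
  have hu' : Unimod (Sum.elim ![φ f₁, φ f₂] (fun i => φ (f i))) := by
    convert hu.map φ using 1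
    ext1 (i | i)
    · fin_cases i <;> rfl
    · rfl
  have h0 : φ f₁ ≠ 0 := (h.map (Ideal.Quotient.mk m)).ne_zero
  obtain ⟨y', hy'⟩ := exists_coprime (φ f₁) (φ f₂) _ h0 hu'
  choose y hy using fun i => hφ (y' i)
  set F := f₂ + ∑ i, y i * f i with hF
  have hφF : φ F = φ f₂ + ∑ i, y' i * φ (f i) := by
    simp [hF, hy]
  rw [← hφF] at hy'
  obtain ⟨a', b', hab⟩ := hy'
  obtain ⟨a, rfl⟩ := hφ a'
  obtain ⟨b, rfl⟩ := hφ b'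
  let I : Ideal B[X] := Ideal.span {f₁, F}
  have hker : 1 - (a * f₁ + b * F) ∈ m.map (C : B →+* B[X]) := by
    have : 1 - (a * f₁ + b * F) ∈ RingHom.ker φ := by
      rw [RingHom.mem_ker]; simp [hab]
    rwa [Polynomial.ker_mapRingHom, Ideal.mk_ker] at this
  have hfin : Module.Finite B (B[X] ⧸ I) := by
    have h1 : Module.Finite B (B[X] ⧸ Ideal.span {f₁}) := h.finite_quotient
    have hle : Ideal.span {f₁} ≤ I := Ideal.span_mono (by simp)
    exact Module.Finite.of_surjective (Ideal.Quotient.factorₐ B hle).toLinearMap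
      (Ideal.Quotient.factor_surjective hle)
  have htop : m.map (algebraMap B (B[X] ⧸ I)) = ⊤ := by
    rw [Ideal.eq_top_iff_one]
    have h1 := Ideal.mem_map_of_mem (Ideal.Quotient.mk I) hker
    rw [Ideal.map_map] at h1
    have h2 : Ideal.Quotient.mk I (a * f₁ + b * F) = 0 := by
      rw [Ideal.Quotient.eq_zero_iff_mem]
      exact I.add_mem (I.mul_mem_left _ (Ideal.subset_span (by simp)))
        (I.mul_mem_left _ (Ideal.subset_span (by simp)))
    rw [map_sub, h2, sub_zero, map_one] at h1
    exact h1
  have hsm : (⊤ : Submodule B (B[X] ⧸ I)) ≤ m • ⊤ := by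
    rw [Ideal.smul_top_eq_map, htop]
    exact fun x _ => trivial
  obtain ⟨r, hr, hr'⟩ := Submodule.exists_sub_one_mem_and_smul_eq_zero_of_fg_of_le_smul m
    (⊤ : Submodule B (B[X] ⧸ I)) hfin.1 hsm
  have h3 := hr' 1 trivial
  have h4 : C r ∈ I := by
    rw [← Ideal.Quotient.eq_zero_iff_mem, ← h3]
    change algebraMap B (B[X] ⧸ I) r = _
    rw [Algebra.algebraMap_eq_smul_one]
  rw [Ideal.mem_span_pair] at h4
  obtain ⟨g₁, g₂, hg⟩ := h4
  refine ⟨y, r, g₁, g₂, fun hrm => hm.ne_top ?_, ?_⟩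
  · rw [Ideal.eq_top_iff_one]
    have := m.sub_mem hrm hr
    simpa using this
  · rw [← hg]; ring

/-- The two by two step. -/
theorem uequiv_two {A : Type*} [CommRing A] [IsDomain A] (r e p q G₁ G₂ α β γ δ : A) (hr : r ≠ 0)
    (h : p * G₁ + q * G₂ = r)
    (h' : (p + r * e * α) * (G₁ + r * e * γ) + (q + r * e * β) * (G₂ + r * e * δ) = r) :
    UEquiv ![p, q] ![p + r * e * α, q + r * e * β] := by
  refine ⟨!![1 + e * (α * G₁ + δ * q), e * (α * G₂ - δ * p);
    e * (β * G₁ - γ * q), 1 + e * (β * G₂ + γ * p)], ?_, ?_⟩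
  · rw [Matrix.isUnit_iff_isUnit_det, Matrix.det_fin_two_of]
    have : r * r * ((1 + e * (α * G₁ + δ * q)) * (1 + e * (β * G₂ + γ * p)) -
      e * (α * G₂ - δ * p) * (e * (β * G₁ - γ * q))) = r * r * 1 := by
      have e1 : r * (1 + e * (α * G₁ + δ * q)) = (p + r * e * α) * G₁ + (G₂ + r * e * δ) * q := by
        linear_combination -h
      have e2 : r * (1 + e * (β * G₂ + γ * p)) = (q + r * e * β) * G₂ + (G₁ + r * e * γ) * p := by
        linear_combination -h
      have e3 : r * (e * (α * G₂ - δ * p)) = (p + r * e * α) * G₂ - (G₂ + r * e * δ) * p := by ring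
      have e4 : r * (e * (β * G₁ - γ * q)) = (q + r * e * β) * G₁ - (G₁ + r * e * γ) * q := by ring
      calc _ = (r * (1 + e * (α * G₁ + δ * q))) * (r * (1 + e * (β * G₂ + γ * p))) -
          (r * (e * (α * G₂ - δ * p))) * (r * (e * (β * G₁ - γ * q))) := by ring
        _ = ((p + r * e * α) * (G₁ + r * e * γ) + (q + r * e * β) * (G₂ + r * e * δ)) *
            (p * G₁ + q * G₂) := by rw [e1, e2, e3, e4]; ring
        _ = _ := by rw [h', h]; ring
    rw [mul_left_cancel₀ (mul_ne_zero hr hr) this]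
    exact isUnit_one
  · ext i
    fin_cases i
    · simp [mulVec, dotProduct]
      linear_combination e * α * h
    · simp [mulVec, dotProduct]
      linear_combination e * β * h

open Polynomial in
theorem comp_congr_dvd {B : Type*} [CommRing B] (f b b' : B[X]) (c : B[X]) (h : c ∣ b' - b) :
    c ∣ f.comp b' - f.comp b := by
  refine h.trans ?_
  exact Polynomial.sub_dvd_eval_sub b' b (f.map C) |>.trans (by
    simp [Polynomial.eval_map, Polynomial.comp])

open Polynomial in
theorem monic_step {B : Type*} [CommRing B] [IsDomain B]
    {κ : Type*} [Fintype κ] [DecidableEq κ] (f₁ f₂ : B[X]) (f : κ → B[X])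
    (y : κ → B[X]) (r : B) (g₁ g₂ : B[X]) (hr : r ≠ 0)
    (hg : C r = f₁ * g₁ + (f₂ + ∑ i, y i * f i) * g₂) (b b' : B[X]) (hb : C r ∣ b' - b) :
    UEquiv (fun i => (Sum.elim ![f₁, f₂] f i).comp b) (fun i => (Sum.elim ![f₁, f₂] f i).comp b') := by
  set F := f₂ + ∑ i, y i * f i with hF
  have h0 : UEquiv (Sum.elim ![f₁, f₂] f) (Sum.elim ![f₁, F] f) := by
    refine UEquiv.elem {i | i ≠ Sum.inl 1} ?_ ?_
    · rintro (i | i) hi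
      · fin_cases i
        · rfl
        · simp at hi
      · rfl
    · rintro i hi
      obtain rfl : i = Sum.inl 1 := by simpa using hi
      simp only [Sum.elim_inl, cons_val_one, hF]
      change f₂ + ∑ i, y i * f i - f₂ ∈ _
      rw [add_sub_cancel_left]
      refine Ideal.sum_mem _ fun j _ => Ideal.mul_mem_left _ _ (Ideal.subset_span ?_)
      exact ⟨Sum.inr j, by simp, rfl⟩
  have hb1 := h0.map (Polynomial.compRingHom b)
  have hb2 := h0.map (Polynomial.compRingHom b')
  simp only [Polynomial.coe_compRingHom_apply] at hb1 hb2
  refine hb1.trans (UEquiv.trans ?_ hb2.symm)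
  obtain ⟨e, he⟩ := hb
  have hd : C r ∣ b' - b := ⟨e, he⟩
  have E : ∀ (b : B[X]) (h : κ → B[X]), (fun i => (Sum.elim ![f₁, F] h i).comp b) =
      Sum.elim ![f₁.comp b, F.comp b] (fun i => (h i).comp b) := by
    intro b h
    ext1 (i | i)
    · fin_cases i <;> rfl
    · rfl
  rw [E, E]
  have hgb : ∀ b, f₁.comp b * g₁.comp b + F.comp b * g₂.comp b = C r := by
    intro b
    have := congrArg (fun p => p.comp b) hg
    simp only [C_comp, add_comp, mul_comp] at this
    exact this.symm
  have key : ∀ g : B[X], ∃ α, g.comp b' = g.comp b + C r * e * α := by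
    intro g
    obtain ⟨α, hα⟩ := comp_congr_dvd g b b' (b' - b) dvd_rfl
    exact ⟨α, by rw [← he, ← hα]; ring⟩
  obtain ⟨α, hα⟩ := key f₁
  obtain ⟨β, hβ⟩ := key F
  obtain ⟨γ, hγ⟩ := key g₁
  obtain ⟨δ, hδ⟩ := key g₂
  have h2 : UEquiv ![f₁.comp b, F.comp b] ![f₁.comp b', F.comp b'] := by
    have h3 := hgb b'
    rw [hα, hβ, hγ, hδ] at h3
    rw [hα, hβ]
    exact uequiv_two (C r) e _ _ (g₁.comp b) (g₂.comp b) α β γ δ (by simpa using hr) (hgb b) h3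
  refine (h2.sum (UEquiv.refl _)).trans ?_
  refine UEquiv.elem (Set.range Sum.inl) ?_ ?_
  · rintro _ ⟨i, rfl⟩; rfl
  · rintro (i | i) hi
    · simp at hi
    · simp only [Sum.elim_inr]
      have h5 : C r ∈ Ideal.span (Sum.elim ![f₁.comp b', F.comp b'] (fun i => (f i).comp b) ''
          Set.range Sum.inl) := by
        rw [← hgb b']
        refine Ideal.add_mem _ (Ideal.mul_mem_right _ _ (Ideal.subset_span ?_))
          (Ideal.mul_mem_right _ _ (Ideal.subset_span ?_))
        · exact ⟨Sum.inl 0, by simp, rfl⟩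
        · exact ⟨Sum.inl 1, by simp, rfl⟩
      exact Ideal.mem_of_dvd _ (comp_congr_dvd (f i) b b' _ hd) h5

open Polynomial in
/-- Suslin's theorem on unimodular rows with a monic entry. -/
theorem monic_theorem {B : Type*} [CommRing B] [IsDomain B]
    {κ : Type*} [Fintype κ] [DecidableEq κ] (f₁ f₂ : B[X]) (f : κ → B[X]) (h : f₁.Monic)
    (hu : Unimod (Sum.elim ![f₁, f₂] f)) :
    UEquiv (Sum.elim ![f₁, f₂] f) (fun i => C ((Sum.elim ![f₁, f₂] f i).eval 0)) := by
  set u := Sum.elim ![f₁, f₂] f with hu_def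
  let J : Ideal B :=
    { carrier := {c | ∀ b b' : B[X], C c ∣ b' - b →
        UEquiv (fun i => (u i).comp b) (fun i => (u i).comp b')}
      zero_mem' := by
        intro b b' hb
        rw [C_0, zero_dvd_iff, sub_eq_zero] at hb
        subst hb
        exact UEquiv.refl _
      add_mem' := by
        intro c d hc hd b b' hb
        obtain ⟨e, he⟩ := hb
        refine (hc b (b + C c * e) ⟨e, by ring⟩).trans (hd _ _ ⟨e, ?_⟩)
        rw [C_add] at he
        linear_combination he
      smul_mem' := by
        intro a c hc b b' hb
        refine hc b b' (dvd_trans ⟨C a, ?_⟩ hb)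
        simp [mul_comm] }
  have hJ : J = ⊤ := by
    by_contra hne
    obtain ⟨m, hm, hJm⟩ := Ideal.exists_le_maximal J hne
    obtain ⟨y, r, g₁, g₂, hr, hg⟩ := exists_local m hm f₁ f₂ f h hu
    refine hr (hJm ?_)
    intro b b' hb
    exact monic_step f₁ f₂ f y r g₁ g₂ (fun h0 => hr (h0 ▸ m.zero_mem)) hg b b' hb
  have h1 : (1 : B) ∈ J := by rw [hJ]; trivial
  have := h1 X 0 (by simp)
  simpa using this

end FM

set_option linter.unusedSectionVars false

namespace FM
open Matrix

theorem UEquiv.scale {R : Type*} [CommRing R] {ι : Type*} [Fintype ι] [DecidableEq ι]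
    (u : ι → R) (i : ι) (a : R) (ha : IsUnit a) : UEquiv u (Function.update u i (a * u i)) := by
  refine ⟨Matrix.diagonal (Function.update 1 i a), ?_, ?_⟩
  · rw [Matrix.isUnit_iff_isUnit_det, det_diagonal, Finset.prod_update_of_mem (Finset.mem_univ i)]
    simpa using ha
  · ext j
    rw [mulVec_diagonal]
    by_cases hj : j = i
    · subst hj; simp
    · simp [hj]

open Polynomial LaurentPolynomial in
theorem laurent_special {B : Type*} [CommRing B] [IsDomain B]
    {κ : Type*} [Fintype κ] [DecidableEq κ] (u : Fin 2 ⊕ κ → B[T;T⁻¹])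
    (a : B[T;T⁻¹]) (ha : IsUnit a) (p : B[X]) (hp : p.Monic) (hp0 : IsUnit (p.coeff 0))
    (hu0 : u (Sum.inl 0) = a * toLaurent p) (hu : Unimod u) :
    UEquiv u (Pi.single (Sum.inl 0) 1) := by
  obtain ⟨a', rfl⟩ := ha
  have h1 := UEquiv.scale u (Sum.inl 0) ((a'⁻¹ : (B[T;T⁻¹])ˣ) : B[T;T⁻¹]) (Units.isUnit _)
  rw [hu0] at h1
  have ea : ((a'⁻¹ : (B[T;T⁻¹])ˣ) : B[T;T⁻¹]) * (a' * toLaurent p) = toLaurent p := by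
    rw [← mul_assoc]; simp
  rw [ea] at h1
  refine h1.trans ?_
  have hu' := h1.unimod hu
  set v := Function.update u (Sum.inl 0) (toLaurent p) with hv
  have hv0 : v (Sum.inl 0) = toLaurent p := by simp [hv]
  clear_value v
  have hcop : ∀ N : ℕ, IsCoprime ((X : B[X]) ^ N) p := by
    intro N
    apply IsCoprime.pow_left
    obtain ⟨c, hc⟩ := hp0
    refine ⟨- Polynomial.C ((c⁻¹ : Bˣ) : B) * p.divX, Polynomial.C ((c⁻¹ : Bˣ) : B), ?_⟩
    have h2 : Polynomial.C ((c⁻¹ : Bˣ) : B) * Polynomial.C (p.coeff 0) = 1 := by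
      rw [← Polynomial.C_mul, ← hc]; simp
    have h3 := p.divX_mul_X_add
    linear_combination h2 - Polynomial.C ((c⁻¹ : Bˣ) : B) * h3
  have hpoly : ∀ w : B[T;T⁻¹], ∃ q : B[X], toLaurent q - w ∈ Ideal.span {toLaurent p} := by
    intro w
    obtain ⟨n, w', hw'⟩ := w.exists_T_pow
    obtain ⟨b, c, hbc⟩ := hcop n
    refine ⟨b * w', ?_⟩
    rw [Ideal.mem_span_singleton]
    refine ⟨- w * toLaurent c, ?_⟩
    have := congrArg toLaurent hbc
    simp only [map_add, map_mul, map_pow, toLaurent_X, T_pow, map_one, mul_one] at this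
    rw [map_mul, hw']
    linear_combination w * this
  choose q hq using fun i => hpoly (v i)
  let w : Fin 2 ⊕ κ → B[X] := Sum.elim ![p, q (Sum.inl 1)] (fun i => q (Sum.inr i))
  have h2 : UEquiv v (fun i => toLaurent (w i)) := by
    refine UEquiv.elem {Sum.inl 0} ?_ ?_
    · rintro i rfl
      simp [w, hv0]
    · intro i hi
      rw [Set.image_singleton, hv0]
      rcases i with i | i
      · fin_cases i
        · simp at hi
        · exact hq (Sum.inl 1)
      · exact hq (Sum.inr i)
  refine h2.trans ?_
  have hu2 := h2.unimod hu'
  have hw : Unimod w := by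
    rw [unimod_iff] at hu2 ⊢
    set I := Ideal.span (Set.range w) with hI
    have hmap : I.map (algebraMap B[X] B[T;T⁻¹]) = ⊤ := by
      rw [hI, Ideal.map_span, ← Set.range_comp]
      exact hu2
    have h3 : (1 : B[T;T⁻¹]) ∈ I.map (algebraMap B[X] B[T;T⁻¹]) := by rw [hmap]; trivial
    rw [IsLocalization.mem_map_algebraMap_iff (Submonoid.powers (X : B[X]))] at h3
    obtain ⟨⟨⟨x, hx⟩, ⟨_, n, rfl⟩⟩, h4⟩ := h3
    rw [one_mul] at h4
    have h5 : X ^ n = x := toLaurent_injective h4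
    obtain ⟨b, c, hbc⟩ := hcop n
    rw [Ideal.eq_top_iff_one, ← hbc, h5]
    exact I.add_mem (I.mul_mem_left _ hx) (I.mul_mem_left _ (Ideal.subset_span ⟨Sum.inl 0, rfl⟩))
  have h3 := (monic_theorem _ _ _ hp hw).map toLaurent
  refine h3.trans (UEquiv.of_isUnit _ ?_)
  simp only [Sum.elim_inl, cons_val_zero, ← coeff_zero_eq_eval_zero]
  exact (hp0.map Polynomial.C).map toLaurent

end FM

set_option linter.unusedSectionVars false

namespace FM
open Matrix

/-- An ideal not contained in any principal prime. -/
def Thick {R : Type*} [CommRing R] (J : Ideal R) : Prop := ∀ p : R, Prime p → ∃ b ∈ J, ¬ p ∣ b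

theorem loc_prime {R S : Type*} [CommRing R] [IsDomain R] [CommRing S] [IsDomain S] [Algebra R S]
    (M : Submonoid R) [IsLocalization M S] (hM : M ≤ nonZeroDivisors R)
    (p : R) (hp : Prime p) (h : ∀ m ∈ M, ¬ p ∣ m) :
    Prime (algebraMap R S p) ∧ ∀ b, algebraMap R S p ∣ algebraMap R S b → p ∣ b := by
  have hinj : Function.Injective (algebraMap R S) := IsLocalization.injective S hM
  constructor
  · have h1 : (Ideal.span {p}).IsPrime := (Ideal.span_singleton_prime hp.ne_zero).2 hp
    have h2 : ((Ideal.span {p}).map (algebraMap R S)).IsPrime := by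
      refine IsLocalization.isPrime_of_isPrime_disjoint M S _ h1 ?_
      rw [Set.disjoint_left]
      intro m hm hm'
      exact h m hm (Ideal.mem_span_singleton.1 hm')
    rw [Ideal.map_span, Set.image_singleton] at h2
    refine (Ideal.span_singleton_prime ?_).1 h2
    rw [Ne, map_eq_zero_iff _ hinj]
    exact hp.ne_zero
  · rintro b ⟨c, hc⟩
    obtain ⟨⟨x, m⟩, hx⟩ := IsLocalization.surj M c
    have : algebraMap R S (b * m) = algebraMap R S (p * x) := by
      rw [map_mul, map_mul, hc, mul_assoc, hx]
    have := hinj this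
    have h2 : p ∣ b * m := ⟨x, this⟩
    exact (hp.dvd_or_dvd h2).resolve_right (h m m.2)

theorem thick_localization {R S : Type*} [CommRing R] [IsDomain R] [UniqueFactorizationMonoid R]
    [CommRing S] [IsDomain S] [Algebra R S]
    (M : Submonoid R) [IsLocalization M S] (hM : M ≤ nonZeroDivisors R) (J : Ideal R)
    (hJ : Thick J) : Thick (J.map (algebraMap R S)) := by
  intro q hq
  have hinj : Function.Injective (algebraMap R S) := IsLocalization.injective S hM
  let P := (Ideal.span {q}).comap (algebraMap R S)
  have hqp : (Ideal.span {q}).IsPrime := (Ideal.span_singleton_prime hq.ne_zero).2 hq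
  have hP : P.IsPrime := Ideal.IsPrime.comap _
  have hP0 : P ≠ ⊥ := by
    obtain ⟨⟨x, m⟩, hx⟩ := IsLocalization.surj M q
    intro h0
    have hxP : x ∈ P := by
      change algebraMap R S x ∈ Ideal.span {q}
      rw [Ideal.mem_span_singleton]
      exact ⟨_, hx.symm⟩
    rw [h0, Ideal.mem_bot] at hxP
    simp only [hxP, map_zero, mul_eq_zero] at hx
    rcases hx with hx | hx
    · exact hq.ne_zero hx
    · exact (IsLocalization.map_units S m).ne_zero hx
  obtain ⟨p, hpP, hp⟩ := hP.exists_mem_prime_of_ne_bot hP0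
  have hpM : ∀ m ∈ M, ¬ p ∣ m := by
    intro m hm hd
    have hmP : algebraMap R S m ∈ Ideal.span {q} := Ideal.mem_of_dvd P hd hpP
    exact hqp.ne_top (Ideal.eq_top_of_isUnit_mem _ hmP (IsLocalization.map_units S ⟨m, hm⟩))
  obtain ⟨hp1, hp2⟩ := loc_prime (S := S) M hM p hp hpM
  have hass : Associated q (algebraMap R S p) :=
    hq.irreducible.associated_of_dvd hp1.irreducible (Ideal.mem_span_singleton.1 hpP)
  obtain ⟨b, hb, hb'⟩ := hJ p hp
  refine ⟨algebraMap R S b, Ideal.mem_map_of_mem _ hb, fun hd => hb' (hp2 b ?_)⟩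
  rwa [← hass.dvd_iff_dvd_left]

theorem Thick.eq_top {R : Type*} [CommRing R] [IsDomain R] [IsPrincipalIdealRing R] (J : Ideal R)
    (hJ : Thick J) (h0 : J ≠ ⊥) : J = ⊤ := by
  by_contra hne
  obtain ⟨m, hm, hJm⟩ := Ideal.exists_le_maximal J hne
  obtain ⟨q, rfl⟩ := (IsPrincipalIdealRing.principal m).principal
  have hq0 : q ≠ 0 := by
    rintro rfl
    apply h0
    rw [eq_bot_iff]
    simpa using hJm
  have hq : Prime q := (Ideal.span_singleton_prime hq0).1 hm.isPrime
  obtain ⟨b, hb, hb'⟩ := hJ q hq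
  exact hb' (Ideal.mem_span_singleton.1 (hJm hb))

open Polynomial in
theorem thick_exists_const {B : Type*} [CommRing B] [IsDomain B] [UniqueFactorizationMonoid B]
    (J : Ideal B[X]) (hJ : Thick J) : ∃ c : B, c ≠ 0 ∧ C c ∈ J := by
  let K := FractionRing B
  let M := (nonZeroDivisors B).map (C : B →+* B[X])
  let _ : Algebra B[X] K[X] := Polynomial.algebra B K
  have hloc : IsLocalization M K[X] := Polynomial.isLocalization (nonZeroDivisors B) K
  have hM : M ≤ nonZeroDivisors B[X] := by
    rintro _ ⟨b, hb, rfl⟩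
    rw [mem_nonZeroDivisors_iff_ne_zero] at *
    simpa using hb
  have hinj : Function.Injective (algebraMap B[X] K[X]) := IsLocalization.injective K[X] hM
  have h1 := thick_localization (S := K[X]) M hM J hJ
  have h2 : J.map (algebraMap B[X] K[X]) ≠ ⊥ := by
    obtain ⟨b, hb, hb'⟩ := hJ X prime_X
    intro h0
    have : algebraMap B[X] K[X] b ∈ J.map (algebraMap B[X] K[X]) := Ideal.mem_map_of_mem _ hb
    rw [h0, Ideal.mem_bot, map_eq_zero_iff _ hinj] at this
    subst this
    simp at hb'
  have h3 := h1.eq_top _ h2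
  have h4 : (1 : K[X]) ∈ J.map (algebraMap B[X] K[X]) := by rw [h3]; trivial
  rw [IsLocalization.mem_map_algebraMap_iff M] at h4
  obtain ⟨⟨⟨x, hx⟩, ⟨_, c, hc, rfl⟩⟩, h4⟩ := h4
  rw [one_mul] at h4
  have h5 := hinj h4
  refine ⟨c, nonZeroDivisors.ne_zero hc, ?_⟩
  have h6 : C c = x := h5
  rw [h6]; exact hx

open Polynomial in
theorem exists_reduce_lead {B : Type*} [CommRing B] (p : B) :
    ∀ (n : ℕ) (f : B[X]), f.support.card ≤ n → ¬ C p ∣ f → 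
    ∃ f₀ f₁ : B[X], f = f₀ + C p * f₁ ∧ ¬ p ∣ f₀.leadingCoeff := by
  intro n
  induction n with
  | zero =>
    intro f hf hd
    have : f = 0 := by simpa using hf
    simp [this] at hd
  | succ n ih =>
    intro f hf hd
    by_cases hl : p ∣ f.leadingCoeff
    · obtain ⟨c, hc⟩ := hl
      have h0 : f ≠ 0 := by rintro rfl; simp at hd
      have e := f.eraseLead_add_C_mul_X_pow
      rw [hc, C_mul] at e
      obtain ⟨f₀, f₁, h1, h2⟩ := ih f.eraseLead (by
        have := eraseLead_support_card_lt h0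
        omega) (by
        intro h3
        apply hd
        rw [← e]
        refine dvd_add h3 ?_
        rw [mul_assoc]
        exact dvd_mul_right _ _)
      refine ⟨f₀, f₁ + C c * X ^ f.natDegree, ?_, h2⟩
      linear_combination h1 - e
    · exact ⟨f, 0, by simp, hl⟩

open Polynomial in
theorem thick_leadingCoeff {B : Type*} [CommRing B] [IsDomain B] [UniqueFactorizationMonoid B]
    (J : Ideal B[X]) (hJ : Thick J) : Thick J.leadingCoeff := by
  intro p hp
  obtain ⟨c, hc0, hc⟩ := thick_exists_const J hJ
  obtain ⟨f, hf, hf'⟩ := hJ (C p) (prime_C_iff.2 hp)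
  obtain ⟨f₀, f₁, h1, h2⟩ := exists_reduce_lead p _ f le_rfl hf'
  obtain ⟨c', e, hc'⟩ := (FiniteMultiplicity.of_prime_left hp hc0).exists_eq_pow_mul_and_not_dvd
  generalize multiplicity p c = a at e
  subst e
  refine ⟨c' * f₀.leadingCoeff ^ a, ?_, ?_⟩
  · rw [Ideal.mem_leadingCoeff]
    refine ⟨C c' * f₀ ^ a, ?_, by simp⟩
    have h3 : f ∣ f₀ ^ a - (- (C p * f₁)) ^ a := by
      have := sub_dvd_pow_sub_pow f₀ (- (C p * f₁)) a
      rwa [sub_neg_eq_add, ← h1] at this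
    obtain ⟨g, hg⟩ := h3
    have : C c' * f₀ ^ a = (C c' * g) * f + ((-1) ^ a * f₁ ^ a) * (C (p ^ a * c')) := by
      rw [C_mul, C_pow]
      have e2 : (-(C p * f₁)) ^ a = (-1) ^ a * C p ^ a * f₁ ^ a := by
        rw [neg_pow, mul_pow]; ring
      rw [e2] at hg
      linear_combination C c' * hg
    rw [this]
    exact J.add_mem (J.mul_mem_left _ hf) (J.mul_mem_left _ hc)
  · intro hd
    rcases hp.dvd_or_dvd hd with h | h
    · exact hc' h
    · exact h2 (hp.dvd_of_dvd_pow h)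

open Polynomial LaurentPolynomial in
theorem thick_laurent {B : Type*} [CommRing B] [IsDomain B] [UniqueFactorizationMonoid B]
    (J : Ideal B[T;T⁻¹]) (hJ : Thick J) (h0 : J ≠ ⊥) : 
    Thick (J.comap (toLaurent : B[X] →+* B[T;T⁻¹])) := by
  intro p hp
  by_cases hpX : p ∣ X
  · obtain ⟨b, hb, hb0⟩ := Submodule.exists_mem_ne_zero_of_ne_bot h0
    obtain ⟨n, q, hq⟩ := b.exists_T_pow
    have hq0 : q ≠ 0 := by
      rintro rfl
      rw [map_zero] at hq
      exact hb0 (by simpa using (((isUnit_T (R := B) n).mul_left_eq_zero).1 hq.symm))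
    obtain ⟨q', e, hq'⟩ :=
      (FiniteMultiplicity.of_prime_left (prime_X (R := B)) hq0).exists_eq_pow_mul_and_not_dvd
    generalize multiplicity X q = k at e
    subst e
    refine ⟨q', ?_, fun h => hq' ?_⟩
    · change toLaurent q' ∈ J
      have : toLaurent q' = (T n * T (-k)) * b := by
        rw [mul_comm (T n * T (-k)), ← mul_assoc, ← hq, map_mul, map_pow, toLaurent_X, T_pow, mul_one,
          mul_right_comm, ← T_add]
        simp
      rw [this]
      exact J.mul_mem_left _ hb
    · have hass : Associated p X := hp.irreducible.associated_of_dvd prime_X.irreducible hpX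
      rwa [← hass.dvd_iff_dvd_left]
  · have hM : Submonoid.powers (X : B[X]) ≤ nonZeroDivisors B[X] := by
      rw [Submonoid.powers_le, mem_nonZeroDivisors_iff_ne_zero]
      exact X_ne_zero
    obtain ⟨h1, h2⟩ := loc_prime (S := B[T;T⁻¹]) (Submonoid.powers (X : B[X])) hM p hp (by
      rintro _ ⟨n, rfl⟩ hd
      exact hpX (hp.dvd_of_dvd_pow hd))
    rw [algebraMap_eq_toLaurent] at h1 h2
    obtain ⟨b, hb, hb'⟩ := hJ _ h1
    obtain ⟨n, q, hq⟩ := b.exists_T_pow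
    refine ⟨q, ?_, ?_⟩
    · change toLaurent q ∈ J
      rw [hq]; exact J.mul_mem_right _ hb
    · rintro hd
      apply hb'
      have h3 : toLaurent p ∣ b * T n := by
        rw [← hq]; exact map_dvd toLaurent hd
      exact ((isUnit_T (R := B) n).dvd_mul_right).1 h3

end FM

set_option linter.unusedSectionVars false

namespace FM
open Matrix

/-- Integral Laurent polynomial ring in `n` variables. -/
abbrev LR (n : ℕ) : Type := AddMonoidAlgebra ℤ (Fin n → ℤ)

theorem LR_isDomain (n : ℕ) : IsDomain (LR n) := inferInstance

open LaurentPolynomial in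
/-- View as one variable Laurent polynomials along a splitting of the exponent group. -/
noncomputable def isoOf {n : ℕ} {G : Type} [AddCommGroup G] (φ : G ≃+ ℤ × (Fin n → ℤ)) :
    AddMonoidAlgebra ℤ G ≃+* (LR n)[T;T⁻¹] :=
  (AddMonoidAlgebra.domCongr ℤ ℤ φ).toRingEquiv.trans AddMonoidAlgebra.curryRingEquiv

theorem isoOf_single {n : ℕ} {G : Type} [AddCommGroup G] (φ : G ≃+ ℤ × (Fin n → ℤ)) (v : G)
    (a : ℤ) : isoOf φ (.single v a) =
      AddMonoidAlgebra.single (φ v).1 (AddMonoidAlgebra.single (φ v).2 a) := by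
  have := AddMonoidAlgebra.curryRingEquiv_single (φ v).1 (φ v).2 a
  simp only [isoOf, RingEquiv.trans_apply]
  rw [← this]
  congr 1
  exact AddMonoidAlgebra.domCongr_single (R := ℤ) φ v a

theorem isoOf_coeff {n : ℕ} {G : Type} [AddCommGroup G] (φ : G ≃+ ℤ × (Fin n → ℤ)) 
    (f : AddMonoidAlgebra ℤ G) (v : G) : 
    ((isoOf φ f).coeff (φ v).1).coeff (φ v).2 = f.coeff v := by
  classical
  induction f using AddMonoidAlgebra.induction_linear with
  | zero => simp
  | add f g hf hg => simp [hf, hg]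
  | single u a =>
    rw [isoOf_single]
    simp only [AddMonoidAlgebra.coeff_single, Finsupp.single_apply]
    by_cases h : u = v
    · subst h; simp
    · by_cases h1 : (φ u).1 = (φ v).1
      · have h2 : (φ u).2 ≠ (φ v).2 := fun h2 => h (φ.injective (Prod.ext h1 h2))
        simp [h, h1, h2]
      · simp [h, h1]

/-- Split off the first coordinate. -/
def consSplit (n : ℕ) : (Fin (n + 1) → ℤ) ≃+ ℤ × (Fin n → ℤ) where
  toFun v := (v 0, Fin.tail v)
  invFun p := Fin.cons p.1 p.2
  left_inv v := by simp
  right_inv p := by simp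
  map_add' u v := by ext <;> simp [Fin.tail]

theorem LR_zero_pid : IsPrincipalIdealRing (LR 0) := by
  refine IsPrincipalIdealRing.of_surjective (AddMonoidAlgebra.singleZeroRingHom : ℤ →+* LR 0) ?_
  intro x
  refine ⟨x.coeff 0, ?_⟩
  refine AddMonoidAlgebra.ext (Finsupp.ext fun v => ?_)
  obtain rfl : v = 0 := Subsingleton.elim _ _
  change (AddMonoidAlgebra.single (0 : Fin 0 → ℤ) (x.coeff 0)).coeff 0 = x.coeff 0
  rw [AddMonoidAlgebra.coeff_single, Finsupp.single_eq_same]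

instance LR_ufd (n : ℕ) : UniqueFactorizationMonoid (LR n) := by
  induction n with
  | zero =>
    have := LR_zero_pid
    infer_instance
  | succ n ih =>
    have h : UniqueFactorizationMonoid (LaurentPolynomial (LR n)) :=
      UniqueFactorizationMonoid.of_isLocalization (Submonoid.powers (Polynomial.X : Polynomial (LR n))) _
    exact (isoOf (consSplit n)).symm.toMulEquiv.uniqueFactorizationMonoid h

theorem Thick.comap_equiv {R S : Type*} [CommRing R] [CommRing S] (e : R ≃+* S) (J : Ideal R)
    (hJ : Thick J) : Thick (J.comap (e.symm : S →+* R)) := by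
  intro p hp
  obtain ⟨b, hb, hb'⟩ := hJ (e.symm p) ((MulEquiv.prime_iff e.symm.toMulEquiv).2 hp)
  refine ⟨e b, by simpa using hb, fun h => hb' ?_⟩
  have := map_dvd e.symm h
  simpa using this

/-- Weights. -/
def wt (K : ℤ) {n : ℕ} (v : Fin n → ℤ) : ℤ := ∑ i, v i * K ^ (i.rev : ℕ)

theorem wt_add (K : ℤ) {n : ℕ} (u v : Fin n → ℤ) : wt K (u + v) = wt K u + wt K v := by
  simp [wt, add_mul, Finset.sum_add_distrib]

theorem wt_neg (K : ℤ) {n : ℕ} (u : Fin n → ℤ) : wt K (-u) = - wt K u := by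
  simp [wt]

theorem wt_sub (K : ℤ) {n : ℕ} (u v : Fin n → ℤ) : wt K (u - v) = wt K u - wt K v := by
  rw [sub_eq_add_neg, wt_add, wt_neg, sub_eq_add_neg]

theorem wt_succ (K : ℤ) {n : ℕ} (v : Fin (n + 1) → ℤ) :
    wt K v = v 0 * K ^ n + wt K (Fin.tail v) := by
  simp [wt, Fin.sum_univ_succ, Fin.tail]

open Filter in
theorem wt_lt {n : ℕ} (v : Fin n → ℤ) : ∀ᶠ K : ℤ in atTop, wt K v < K ^ n := by
  induction n with
  | zero => simp [wt]
  | succ n ih =>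
    filter_upwards [ih (Fin.tail v), eventually_ge_atTop (v 0 + 1), eventually_ge_atTop 0]
      with K h1 h2 h3
    rw [wt_succ]
    have : (v 0 + 1) * K ^ n ≤ K * K ^ n := mul_le_mul_of_nonneg_right h2 (pow_nonneg h3 n)
    rw [pow_succ]
    linarith

open Polynomial LaurentPolynomial in
theorem coeff_toLaurent_nat {B : Type*} [CommRing B] (F : B[X]) (m : ℕ) :
    (toLaurent F).coeff (m : ℤ) = F.coeff m := by
  induction F using Polynomial.induction_on' with
  | add p q hp hq => simp only [map_add, AddMonoidAlgebra.coeff_add, Finsupp.add_apply, hp, hq, 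
      Polynomial.coeff_add]
  | monomial k a =>
    rw [← Polynomial.C_mul_X_pow_eq_monomial, Polynomial.toLaurent_C_mul_X_pow,
      ← single_eq_C_mul_T, AddMonoidAlgebra.coeff_single, Finsupp.single_apply,
      Polynomial.coeff_C_mul_X_pow]
    simp [eq_comm]

open Polynomial LaurentPolynomial in
theorem coeff_toLaurent_ne {B : Type*} [CommRing B] (F : B[X]) (m : ℤ)
    (h : (toLaurent F).coeff m ≠ 0) : ∃ k : ℕ, m = k ∧ k ≤ F.natDegree ∧ F.coeff k ≠ 0 := by
  have h1 : m ∈ (toLaurent F).coeff.support := Finsupp.mem_support_iff.2 h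
  rw [support_coeff_toLaurent] at h1
  simp only [Finset.mem_map, Polynomial.mem_support_iff] at h1
  obtain ⟨k, hk, rfl⟩ := h1
  exact ⟨k, rfl, Polynomial.le_natDegree_of_ne_zero hk, hk⟩

open Filter Polynomial LaurentPolynomial in
theorem thick_LR {n : ℕ} (J : Ideal (LR n)) (hJ : Thick J) (h0 : J ≠ ⊥) :
    ∃ f ∈ J, ∃ v, f.coeff v = 1 ∧ ∀ᶠ K : ℤ in atTop, ∀ u ∈ f.coeff.support, u ≠ v →
      wt K u < wt K v := by
  induction n with
  | zero =>
    have := LR_zero_pid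
    have := hJ.eq_top J h0
    refine ⟨1, by rw [this]; trivial, 0, by simp [AddMonoidAlgebra.one_def], ?_⟩
    exact Eventually.of_forall fun K u _ hu => absurd (Subsingleton.elim u 0) hu
  | succ n ih =>
    let e := isoOf (consSplit n)
    let J₁ : Ideal (LR n)[T;T⁻¹] := J.comap (e.symm : (LR n)[T;T⁻¹] →+* LR (n + 1))
    have hJ₁ : Thick J₁ := hJ.comap_equiv e
    have hJ₁0 : J₁ ≠ ⊥ := by
      obtain ⟨b, hb, hb0⟩ := Submodule.exists_mem_ne_zero_of_ne_bot h0
      intro h1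
      have : e b ∈ J₁ := by
        change e.symm (e b) ∈ J
        simpa using hb
      rw [h1, Ideal.mem_bot] at this
      exact hb0 (by simpa using this)
    have hJ₂ := thick_laurent J₁ hJ₁ hJ₁0
    set J₂ := J₁.comap (toLaurent : (LR n)[X] →+* (LR n)[T;T⁻¹]) with hJ₂d
    have hJ₃ := thick_leadingCoeff J₂ hJ₂
    have hJ₃0 : J₂.leadingCoeff ≠ ⊥ := by
      obtain ⟨c, hc, hc'⟩ := thick_exists_const J₂ hJ₂
      intro h1
      have : c ∈ J₂.leadingCoeff := (Ideal.mem_leadingCoeff _ _).2 ⟨_, hc', by simp⟩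
      rw [h1] at this
      exact hc this
    obtain ⟨g, hg, v', hv', hK⟩ := ih _ hJ₃ hJ₃0
    rw [Ideal.mem_leadingCoeff] at hg
    obtain ⟨F, hF, rfl⟩ := hg
    refine ⟨e.symm (toLaurent F), hF, Fin.cons (F.natDegree : ℤ) v', ?_, ?_⟩
    · rw [← isoOf_coeff (consSplit n)]
      change ((e (e.symm (toLaurent F))).coeff _).coeff _ = _
      rw [RingEquiv.apply_symm_apply]
      simp only [consSplit, AddEquiv.coe_mk, Equiv.coe_fn_mk, Fin.cons_zero, Fin.tail_cons]
      rw [coeff_toLaurent_nat]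
      exact hv'
    · set f := e.symm (toLaurent F) with hf
      have hall : ∀ᶠ K : ℤ in atTop, ∀ u ∈ f.coeff.support, wt K (Fin.tail u - v') < K ^ n :=
        (Filter.eventually_all_finset _).2 fun u _ => wt_lt _
      filter_upwards [hK, hall, eventually_ge_atTop 0] with K h1 h2 h3
      intro u hu huv
      have h4 := h2 u hu
      rw [wt_sub] at h4
      have h5 : ((toLaurent F).coeff (u 0)).coeff (Fin.tail u) ≠ 0 := by
        have := isoOf_coeff (consSplit n) f u
        change ((e (e.symm (toLaurent F))).coeff _).coeff _ = _ at this
        rw [RingEquiv.apply_symm_apply] at this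
        simp only [consSplit, AddEquiv.coe_mk, Equiv.coe_fn_mk] at this
        rw [this]
        simpa using hu
      have h6 : (toLaurent F).coeff (u 0) ≠ 0 := by
        intro h6; rw [h6] at h5; simp at h5
      obtain ⟨k, hk, hkd, hk0⟩ := coeff_toLaurent_ne F _ h6
      rw [wt_succ, wt_succ K (Fin.cons _ _)]
      simp only [Fin.cons_zero, Fin.tail_cons]
      rcases hkd.lt_or_eq with hlt | heq
      · have h7 : ((k : ℤ) + 1) * K ^ n ≤ F.natDegree * K ^ n :=
          mul_le_mul_of_nonneg_right (by exact_mod_cast hlt) (pow_nonneg h3 n)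
        rw [hk]
        linarith
      · have h8 : Fin.tail u ∈ F.leadingCoeff.coeff.support := by
          rw [hk, coeff_toLaurent_nat, heq] at h5
          simpa using h5
        have h9 : Fin.tail u ≠ v' := by
          intro h9
          apply huv
          rw [← h9, ← heq, ← hk]
          simp
        have := h1 _ h8 h9
        rw [hk, heq]
        linarith

end FM

set_option linter.unusedSectionVars false

namespace FM
open Matrix

section laurent
open Polynomial LaurentPolynomial

theorem coeff_mul_T {B : Type*} [CommRing B] (x : B[T;T⁻¹]) (k m : ℤ) :
    (x * T k).coeff m = x.coeff (m - k) := by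
  have := AddMonoidAlgebra.coeff_mul_single_apply x (1 : B) k m
  rw [mul_one] at this
  rw [sub_eq_add_neg]
  exact this

theorem laurent_bound {B : Type*} [CommRing B] (x : B[T;T⁻¹]) :
    ∃ N : ℤ, 0 ≤ N ∧ ∀ m, N < |m| → x.coeff m = 0 := by
  refine ⟨∑ m ∈ x.coeff.support, |m|, Finset.sum_nonneg fun _ _ => abs_nonneg _, ?_⟩
  intro m hm
  by_contra h
  have := Finset.single_le_sum (f := fun m : ℤ => |m|) (fun _ _ => abs_nonneg _)
    (Finsupp.mem_support_iff.2 h)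
  omega

theorem exists_toLaurent {B : Type*} [CommRing B] (x : B[T;T⁻¹])
    (h : ∀ m, m < 0 → x.coeff m = 0) : ∃ q : B[X], toLaurent q = x := by
  obtain ⟨n, q, hq⟩ := x.exists_T_pow
  have key : ∀ n : ℕ, ∀ q : B[X], toLaurent q = x * T n → ∃ q : B[X], toLaurent q = x := by
    intro n
    induction n with
    | zero => intro q hq; exact ⟨q, by simpa using hq⟩
    | succ n ih =>
      intro q hq
      have h0 : q.coeff 0 = 0 := by
        have h1 := coeff_toLaurent_nat q 0
        rw [hq] at h1
        rw [← h1, coeff_mul_T]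
        exact h _ (by push_cast; omega)
      obtain ⟨q', rfl⟩ := X_dvd_iff.2 h0
      refine ih q' ?_
      rw [map_mul, toLaurent_X] at hq
      have : T (-1) * (T 1 * toLaurent q') = T (-1) * (x * T ((n + 1 : ℕ) : ℤ)) := by rw [hq]
      rw [← mul_assoc, ← T_add, mul_comm (T (-1)), mul_assoc, ← T_add] at this
      simpa using this
  exact key n q hq

theorem exists_special {B : Type*} [CommRing B] [IsDomain B] (x : B[T;T⁻¹]) (D E : ℤ)
    (hD : IsUnit (x.coeff D)) (hD' : ∀ m, D < m → x.coeff m = 0)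
    (hE : IsUnit (x.coeff E)) (hE' : ∀ m, m < E → x.coeff m = 0) :
    ∃ (a : B[T;T⁻¹]) (p : B[X]), IsUnit a ∧ p.Monic ∧ IsUnit (p.coeff 0) ∧ x = a * toLaurent p := by
  have hco : ∀ m, (x * T (-E)).coeff m = x.coeff (m + E) := by
    intro m
    rw [coeff_mul_T, sub_neg_eq_add]
  obtain ⟨q, hq⟩ := exists_toLaurent (x * T (-E)) (by
    intro m hm
    rw [hco]
    exact hE' _ (by omega))
  have hqc : ∀ k : ℕ, q.coeff k = x.coeff (k + E) := by
    intro k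
    rw [← coeff_toLaurent_nat, hq, hco]
  have hED : E ≤ D := by
    by_contra h
    exact hE.ne_zero (hD' _ (by omega))
  have hdeg : q.natDegree = (D - E).toNat := by
    apply le_antisymm
    · rw [natDegree_le_iff_coeff_eq_zero]
      intro k hk
      rw [hqc]
      exact hD' _ (by omega)
    · apply le_natDegree_of_ne_zero
      rw [hqc]
      have : ((D - E).toNat : ℤ) + E = D := by omega
      rw [this]
      exact hD.ne_zero
  have hlc : q.leadingCoeff = x.coeff D := by
    rw [leadingCoeff, hdeg, hqc]
    congr 1
    omega
  obtain ⟨c, hc⟩ := hD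
  refine ⟨LaurentPolynomial.C (c : B) * T E, Polynomial.C ((c⁻¹ : Bˣ) : B) * q, ?_, ?_, ?_, ?_⟩
  · exact (c.isUnit.map LaurentPolynomial.C).mul (isUnit_T E)
  · rw [Monic, leadingCoeff_mul, leadingCoeff_C, hlc, ← hc]; simp
  · rw [Polynomial.coeff_C_mul, hqc]
    refine (Units.isUnit _).mul ?_
    simpa using hE
  · rw [map_mul, hq, toLaurent_C]
    have e1 : LaurentPolynomial.C (c : B) * LaurentPolynomial.C ((c⁻¹ : Bˣ) : B) = 1 := by
      rw [← map_mul]; simp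
    have e2 : (T E : B[T;T⁻¹]) * T (-E) = 1 := by rw [← T_add]; simp
    calc x = (LaurentPolynomial.C (c : B) * LaurentPolynomial.C ((c⁻¹ : Bˣ) : B)) *
        (T E * T (-E)) * x := by rw [e1, e2]; simp
      _ = _ := by ring

end laurent

/-- Split off the weight. -/
def wtSplit (K : ℤ) (n : ℕ) : (Fin (n + 1) → ℤ) ≃+ ℤ × (Fin n → ℤ) where
  toFun v := (wt K v, Fin.init v)
  invFun p := Fin.snoc p.2 (p.1 - wt K (Fin.snoc p.2 0 : Fin (n + 1) → ℤ))
  left_inv v := by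
    ext i
    refine Fin.lastCases ?_ (fun i => ?_) i
    · simp [wt, Fin.sum_univ_castSucc, Fin.init]
    · simp [Fin.init]
  right_inv p := by
    ext
    · simp [wt, Fin.sum_univ_castSucc]
    · simp
  map_add' u v := by
    ext
    · simp [wt_add]
    · simp [Fin.init]

theorem single_isUnit {n : ℕ} (v : Fin n → ℤ) : IsUnit (AddMonoidAlgebra.single v (1 : ℤ) : LR n) := by
  refine IsUnit.of_mul_eq_one (AddMonoidAlgebra.single (-v) 1) ?_
  rw [AddMonoidAlgebra.single_mul_single]
  simp [AddMonoidAlgebra.one_def]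

theorem wt_coeff_top {n : ℕ} (K : ℤ) (f : LR (n + 1)) (v : Fin (n + 1) → ℤ) (hv : f.coeff v = 1)
    (h : ∀ u ∈ f.coeff.support, u ≠ v → wt K u ≠ wt K v) :
    IsUnit ((isoOf (wtSplit K n) f).coeff (wt K v)) := by
  have : (isoOf (wtSplit K n) f).coeff (wt K v) = AddMonoidAlgebra.single (Fin.init v) 1 := by
    refine AddMonoidAlgebra.ext (Finsupp.ext fun b => ?_)
    obtain ⟨u, hu⟩ := (wtSplit K n).surjective (wt K v, b)
    have h1 : wt K u = wt K v := congrArg Prod.fst hu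
    have h2 : Fin.init u = b := congrArg Prod.snd hu
    have h3 := isoOf_coeff (wtSplit K n) f u
    rw [hu] at h3
    rw [h3, AddMonoidAlgebra.coeff_single]
    by_cases huv : u = v
    · subst huv
      rw [← h2]; simp [hv]
    · have h4 : f.coeff u = 0 := by
        by_contra h4
        exact h u (Finsupp.mem_support_iff.2 h4) huv h1
      have h5 : Fin.init v ≠ b := by
        intro h5
        apply huv
        apply (wtSplit K n).injective
        rw [hu, ← h5]
        rfl
      rw [h4, Finsupp.single_eq_of_ne (Ne.symm h5)]
  rw [this]
  exact single_isUnit _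

theorem wt_coeff_zero {n : ℕ} (K : ℤ) (f : LR (n + 1)) (m : ℤ)
    (h : ∀ u ∈ f.coeff.support, wt K u ≠ m) :
    (isoOf (wtSplit K n) f).coeff m = 0 := by
  refine AddMonoidAlgebra.ext (Finsupp.ext fun b => ?_)
  obtain ⟨u, hu⟩ := (wtSplit K n).surjective (m, b)
  have h1 : wt K u = m := congrArg Prod.fst hu
  have h3 := isoOf_coeff (wtSplit K n) f u
  rw [hu] at h3
  rw [h3]
  by_contra h4
  exact h u (Finsupp.mem_support_iff.2 h4) h1

theorem thick_LR_neg {n : ℕ} (J : Ideal (LR n)) (hJ : Thick J) (h0 : J ≠ ⊥) :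
    ∃ f ∈ J, ∃ v, f.coeff v = 1 ∧ ∀ᶠ K : ℤ in Filter.atTop, ∀ u ∈ f.coeff.support, u ≠ v →
      wt K v < wt K u := by
  let e : LR n ≃+* LR n := (AddMonoidAlgebra.domCongr ℤ ℤ (AddEquiv.neg (Fin n → ℤ))).toRingEquiv
  have he : ∀ (f : LR n) v, (e.symm f).coeff v = f.coeff (-v) := by
    intro f v
    exact AddMonoidAlgebra.coeff_domCongr (R := ℤ) (AddEquiv.neg (Fin n → ℤ)).symm f v
  obtain ⟨f, hf, v, hv, hK⟩ := thick_LR (J.comap (e.symm : LR n →+* LR n)) (hJ.comap_equiv e) (by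
    obtain ⟨b, hb, hb0⟩ := Submodule.exists_mem_ne_zero_of_ne_bot h0
    intro h1
    have : e b ∈ J.comap (e.symm : LR n →+* LR n) := by
      change e.symm (e b) ∈ J
      simpa using hb
    rw [h1, Ideal.mem_bot] at this
    exact hb0 (by simpa using this))
  refine ⟨e.symm f, hf, -v, by rw [he, neg_neg, hv], ?_⟩
  filter_upwards [hK] with K h u hu huv
  rw [Finsupp.mem_support_iff, he] at hu
  have := h (-u) (Finsupp.mem_support_iff.2 hu) (by rintro rfl; simp at huv)
  rw [wt_neg] at this ⊢
  linarith

open Polynomial LaurentPolynomial in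
theorem herm_aux {n : ℕ} {κ : Type} [Fintype κ] [DecidableEq κ] (k₀ : κ)
    (u : Fin 2 ⊕ κ → LR (n + 1)) (hu : Unimod u) (h0 : u (Sum.inr k₀) ≠ 0) :
    UEquiv u (Pi.single (Sum.inl 0) 1) := by
  obtain ⟨y, hy⟩ := exists_prod_trick (u (Sum.inr k₀)) (u (Sum.inl 1)) h0
  let w := Function.update u (Sum.inl 1) (u (Sum.inl 1) + y * u (Sum.inl 0))
  have hw1 : w (Sum.inl 1) = u (Sum.inl 1) + y * u (Sum.inl 0) := by simp [w]
  have hw : ∀ i, i ≠ Sum.inl 1 → w i = u i := fun i hi => by simp [w, hi]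
  have huw : UEquiv u w := by
    refine UEquiv.elem {Sum.inl 0} ?_ ?_
    · rintro i rfl; exact hw _ (by simp)
    · intro i _
      by_cases hi1 : i = Sum.inl 1
      · subst hi1
        rw [hw1, add_sub_cancel_left]
        exact Ideal.mul_mem_left _ _ (Ideal.subset_span ⟨_, rfl, rfl⟩)
      · rw [hw i hi1]; simp
  refine huw.trans ?_
  have huw' := huw.unimod hu
  set J := Ideal.span (w '' {i | i ≠ Sum.inl 0}) with hJd
  have hmem : ∀ i, i ≠ Sum.inl 0 → w i ∈ J := fun i hi => Ideal.subset_span ⟨i, hi, rfl⟩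
  have hJ : Thick J := by
    intro p hp
    by_contra hcon
    push Not at hcon
    have hd : ∀ i, i ≠ Sum.inl 0 → p ∣ w i := fun i hi => hcon _ (hmem i hi)
    have h2 : p ∣ u (Sum.inr k₀) := by
      rw [← hw _ (by simp)]; exact hd _ (by simp)
    have h1 := hd (Sum.inl 1) (by simp)
    rw [hw1] at h1
    by_cases hpb : p ∣ u (Sum.inl 1)
    · have h3 := (dvd_add_right hpb).1 h1
      have h4 : p ∣ u (Sum.inl 0) :=
        (hp.dvd_or_dvd h3).resolve_left (fun h5 => (hy p hp h2).1 h5 hpb)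
      apply hp.not_isUnit
      obtain ⟨c, hc⟩ := huw'
      rw [isUnit_iff_dvd_one, ← hc]
      refine Finset.dvd_sum fun i _ => Dvd.dvd.mul_left ?_ _
      by_cases hi : i = Sum.inl 0
      · subst hi; rw [hw _ (by simp)]; exact h4
      · exact hd i hi
    · have := (hy p hp h2).2 hpb
      exact hpb ((dvd_add_left (this.mul_right _)).1 h1)
  have hJ0 : J ≠ ⊥ := by
    intro h1
    have := hmem (Sum.inr k₀) (by simp)
    rw [h1, Ideal.mem_bot, hw _ (by simp)] at this
    exact h0 this
  obtain ⟨f, hf, v, hv, hK⟩ := thick_LR J hJ hJ0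
  obtain ⟨f', hf', v', hv', hK'⟩ := thick_LR_neg J hJ hJ0
  obtain ⟨K, hK, hK'⟩ := (hK.and hK').exists
  let e := isoOf (wtSplit K n)
  have a1 : IsUnit ((e f).coeff (wt K v)) :=
    wt_coeff_top K f v hv (fun u hu huv => (hK u hu huv).ne)
  have a2 : IsUnit ((e f').coeff (wt K v')) :=
    wt_coeff_top K f' v' hv' (fun u hu huv => (hK' u hu huv).ne')
  have b1 : ∀ m, wt K v < m → (e f).coeff m = 0 := by
    intro m hm
    refine wt_coeff_zero K f m fun u hu => ?_
    by_cases huv : u = v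
    · subst huv; exact hm.ne
    · exact ((hK u hu huv).trans hm).ne
  have b2 : ∀ m, m < wt K v' → (e f').coeff m = 0 := by
    intro m hm
    refine wt_coeff_zero K f' m fun u hu => ?_
    by_cases huv : u = v'
    · subst huv; exact hm.ne'
    · exact (hm.trans (hK' u hu huv)).ne'
  clear_value e
  obtain ⟨N₀, hN₀, c0⟩ := laurent_bound (e (w (Sum.inl 0)))
  obtain ⟨N₁, hN₁, c1⟩ := laurent_bound (e f)
  obtain ⟨N₂, hN₂, c2⟩ := laurent_bound (e f')
  generalize wt K v = d at *
  generalize wt K v' = d' at *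
  let s : ℤ := |d| + N₀ + N₁ + N₂ + 1
  let s' : ℤ := - (|d'| + N₀ + N₁ + N₂ + 1)
  let x := e (w (Sum.inl 0)) + e f * T s + e f' * T s'
  have hxc : ∀ m, x.coeff m = (e (w (Sum.inl 0))).coeff m + (e f).coeff (m - s) +
      (e f').coeff (m - s') := by
    intro m
    simp only [x, AddMonoidAlgebra.coeff_add, Finsupp.add_apply, coeff_mul_T]
  have hd1 := le_abs_self d
  have hd2 := neg_abs_le d
  have hd3 := le_abs_self d'
  have hd4 := neg_abs_le d'
  obtain ⟨a, p, ha, hp, hp0, hx⟩ := exists_special x (d + s) (d' + s')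
    (by
      rw [hxc, c0 _ (by rw [lt_abs]; left; omega), c2 _ (by rw [lt_abs]; left; omega)]
      simpa using a1)
    (by
      intro m hm
      rw [hxc, c0 _ (by rw [lt_abs]; left; omega), c2 _ (by rw [lt_abs]; left; omega),
        b1 _ (by omega)]
      simp)
    (by
      rw [hxc, c0 _ (by rw [lt_abs]; right; omega), c1 _ (by rw [lt_abs]; right; omega)]
      simpa using a2)
    (by
      intro m hm
      rw [hxc, c0 _ (by rw [lt_abs]; right; omega), c1 _ (by rw [lt_abs]; right; omega),
        b2 _ (by omega)]
      simp)
  have hw2 : UEquiv w (Function.update w (Sum.inl 0) (e.symm x)) := by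
    refine UEquiv.elem {i | i ≠ Sum.inl 0} ?_ ?_
    · intro i hi
      rw [Function.update_of_ne hi]
    · intro i hi
      obtain rfl : i = Sum.inl 0 := by simpa using hi
      rw [Function.update_self]
      have : e.symm x - w (Sum.inl 0) = e.symm (T s) * f + e.symm (T s') * f' := by
        simp only [x, map_add, map_mul, RingEquiv.symm_apply_apply]
        ring
      rw [this]
      exact J.add_mem (J.mul_mem_left _ hf) (J.mul_mem_left _ hf')
  refine hw2.trans ?_
  have hun := (hw2.unimod huw').map (e : LR (n + 1) →+* (LR n)[T;T⁻¹])
  have := (laurent_special _ a ha p hp hp0 (by simpa using hx) hun).map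
    (e.symm : (LR n)[T;T⁻¹] →+* LR (n + 1))
  convert this using 1
  · ext i; simp
  · ext i
    by_cases hi : i = Sum.inl 0
    · subst hi; simp
    · simp [hi]

theorem herm_two {R : Type*} [CommRing R] (u : Fin 2 → R) (hu : Unimod u) :
    UEquiv u (Pi.single 0 1) := by
  obtain ⟨c, hc⟩ := hu
  rw [Fin.sum_univ_two] at hc
  refine ⟨!![c 0, c 1; - u 1, u 0], ?_, ?_⟩
  · rw [Matrix.isUnit_iff_isUnit_det, Matrix.det_fin_two_of]
    have : c 0 * u 0 - c 1 * (-u 1) = 1 := by linear_combination hc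
    rw [this]; exact isUnit_one
  · ext i
    fin_cases i
    · simpa [mulVec, dotProduct] using hc
    · simp [mulVec, dotProduct]; ring

theorem herm_succ (n : ℕ) : Herm (LR (n + 1)) := by
  intro ι _ _ i u hu
  suffices h : ∃ j, UEquiv u (Pi.single j 1) by
    obtain ⟨j, hj⟩ := h
    exact hj.trans (UEquiv.single_single j i)
  have hex : ∃ i₂, u i₂ ≠ 0 := by
    by_contra h
    push Not at h
    obtain ⟨c, hc⟩ := hu
    simp [h] at hc
  obtain ⟨i₂, hi₂⟩ := hex
  have back : ∀ {κ : Type} [Fintype κ] [DecidableEq κ] (e : κ ≃ ι) (k : κ),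
      UEquiv (u ∘ e) (Pi.single k 1) → ∃ j, UEquiv u (Pi.single j 1) := by
    intro κ _ _ e k h
    refine ⟨e k, UEquiv.of_reindex e ?_⟩
    convert h using 1
    ext1 j
    simp [Pi.single_apply]
  obtain ⟨m, hm⟩ : ∃ m, Fintype.card ι = m := ⟨_, rfl⟩
  match m, hm with
  | 0, hm =>
    have : Nonempty ι := ⟨i⟩
    exact absurd hm Fintype.card_ne_zero
  | 1, hm =>
    refine ⟨i, UEquiv.of_isUnit i ?_⟩
    obtain ⟨c, hc⟩ := hu
    have : Subsingleton ι := Fintype.card_le_one_iff_subsingleton.1 hm.le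
    rw [Fintype.sum_subsingleton _ i] at hc
    exact IsUnit.of_mul_eq_one (c i) (by rw [mul_comm]; exact hc)
  | 2, hm =>
    let e : Fin 2 ≃ ι := Fintype.equivOfCardEq (by simp [hm])
    exact back e 0 (herm_two _ (hu.reindex e))
  | m + 3, hm =>
    let e : Fin 2 ⊕ Fin (m + 1) ≃ ι := Fintype.equivOfCardEq (by simp [hm]; ring)
    let e' := (Equiv.swap (Sum.inr 0) (e.symm i₂)).trans e
    refine back e' (Sum.inl 0) (herm_aux 0 _ (hu.reindex e') ?_)
    simpa [e'] using hi₂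

theorem Herm.retract {R S : Type} [CommRing R] [CommRing S] (hR : Herm R) (f : R →+* S)
    (g : S →+* R) (hfg : ∀ x, f (g x) = x) : Herm S := by
  intro ι _ _ i u hu
  have := (hR ι i _ (hu.map g)).map f
  convert this using 1
  · ext; simp [hfg]
  · ext j
    by_cases hj : j = i
    · subst hj; simp
    · simp [hj]

/-- The augmentation. -/
noncomputable def aug (n : ℕ) : LR n →+* ℤ :=
  AddMonoidAlgebra.liftNCRingHom (RingHom.id ℤ) (1 : Multiplicative (Fin n → ℤ) →* ℤ)
    (fun _ _ => Commute.all _ _)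

@[simp] theorem aug_single (n : ℕ) (v : Fin n → ℤ) (a : ℤ) : aug n (.single v a) = a := by
  simp [aug]

theorem herm_int : Herm ℤ :=
  (herm_succ 0).retract (aug 1) (algebraMap ℤ _) (fun x => by simp)

/-- Functoriality in the exponent group. -/
noncomputable def mapExp {m n : ℕ} (p : (Fin m → ℤ) →+ (Fin n → ℤ)) : LR m →+* LR n :=
  AddMonoidAlgebra.mapDomainRingHom ℤ p

@[simp] theorem mapExp_single {m n : ℕ} (p : (Fin m → ℤ) →+ (Fin n → ℤ)) (v : Fin m → ℤ) (a : ℤ) :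
    mapExp p (.single v a) = .single (p v) a := by
  simp [mapExp]

theorem mapExp_comp {m n k : ℕ} (p : (Fin m → ℤ) →+ (Fin n → ℤ)) (q : (Fin n → ℤ) →+ (Fin k → ℤ))
    (x : LR m) : mapExp q (mapExp p x) = mapExp (q.comp p) x := by
  induction x using AddMonoidAlgebra.induction_linear with
  | zero => simp
  | add f g hf hg => simp [hf, hg]
  | single u a => simp

theorem mapExp_id {m : ℕ} (x : LR m) : mapExp (AddMonoidHom.id _) x = x := by
  induction x using AddMonoidAlgebra.induction_linear with
  | zero => simp
  | add f g hf hg => simp [hf, hg]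
  | single u a => simp

theorem aug_mapExp {m n : ℕ} (p : (Fin m → ℤ) →+ (Fin n → ℤ)) (x : LR m) :
    aug n (mapExp p x) = aug m x := by
  induction x using AddMonoidAlgebra.induction_linear with
  | zero => simp
  | add f g hf hg => simp [hf, hg]
  | single u a => simp

/-- Forget the first coordinate. -/
def tailHom (n : ℕ) : (Fin (n + 1) → ℤ) →+ (Fin n → ℤ) where
  toFun v := Fin.tail v
  map_zero' := rfl
  map_add' _ _ := rfl

/-- Extend by zero. -/
def consHom (n : ℕ) : (Fin n → ℤ) →+ (Fin (n + 1) → ℤ) where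
  toFun v := Fin.cons 0 v
  map_zero' := by ext i; refine Fin.cases ?_ (fun i => ?_) i <;> simp
  map_add' u v := by ext i; refine Fin.cases ?_ (fun i => ?_) i <;> simp

theorem tail_cons_exp {n : ℕ} (x : LR n) : mapExp (tailHom n) (mapExp (consHom n) x) = x := by
  rw [mapExp_comp]
  exact mapExp_id x

theorem herm_LR (n : ℕ) : Herm (LR n) :=
  (herm_succ n).retract (mapExp (tailHom n)) (mapExp (consHom n)) tail_cons_exp

end FM

set_option linter.unusedSectionVars false

namespace FM
open Matrix

/-- monomials -/
noncomputable def tm {n : ℕ} (v : Fin n → ℤ) : LR n := .single v 1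

@[simp] theorem tm_zero {n : ℕ} : tm (0 : Fin n → ℤ) = 1 := rfl

theorem tm_add {n : ℕ} (u v : Fin n → ℤ) : tm (u + v) = tm u * tm v := by
  simp [tm, AddMonoidAlgebra.single_mul_single]

@[simp] theorem aug_tm {n : ℕ} (v : Fin n → ℤ) : aug n (tm v) = 1 := by simp [tm]

@[simp] theorem mapExp_tm {m n : ℕ} (p : (Fin m → ℤ) →+ (Fin n → ℤ)) (v : Fin m → ℤ) :
    mapExp p (tm v) = tm (p v) := by simp [tm]

theorem tm_inj {n : ℕ} {u v : Fin n → ℤ} (h : tm u = tm v) : u = v := by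
  have := congrArg (fun x : LR n => x.coeff u) h
  simp only [tm, AddMonoidAlgebra.coeff_single, Finsupp.single_apply] at this
  by_contra hne
  simp [Ne.symm hne] at this

theorem LR_single_eq {n : ℕ} (u : Fin n → ℤ) (a : ℤ) :
    (AddMonoidAlgebra.single u a : LR n) = (a : LR n) * tm u := by
  have : (a : LR n) = AddMonoidAlgebra.single 0 a := by
    rw [AddMonoidAlgebra.intCast_def]; simp
  rw [this, tm, AddMonoidAlgebra.single_mul_single]
  simp

/-- The subgroup of exponents trivial modulo an ideal. -/
theorem tm_sub_one_mem {n : ℕ} (J : Ideal (LR n)) (s : Set (Fin n → ℤ))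
    (hs : ∀ v ∈ s, tm v - 1 ∈ J) (v : Fin n → ℤ) (hv : v ∈ AddSubgroup.closure s) :
    tm v - 1 ∈ J := by
  induction hv using AddSubgroup.closure_induction with
  | mem x hx => exact hs x hx
  | zero => simp
  | add x y _ _ hx hy =>
    have : tm (x + y) - 1 = tm x * (tm y - 1) + (tm x - 1) := by rw [tm_add]; ring
    rw [this]
    exact J.add_mem (J.mul_mem_left _ hy) hx
  | neg x _ hx =>
    have h : tm (-x) * tm x = 1 := by rw [← tm_add]; simp
    have : tm (-x) - 1 = - tm (-x) * (tm x - 1) := by linear_combination h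
    rw [this]
    exact J.mul_mem_left _ hx

theorem sub_mapExp_mem {n : ℕ} (q : (Fin n → ℤ) →+ (Fin n → ℤ)) (J : Ideal (LR n))
    (s : Set (Fin n → ℤ)) (hs : ∀ v ∈ s, tm v - 1 ∈ J)
    (hq : ∀ v, v - q v ∈ AddSubgroup.closure s) (x : LR n) : x - mapExp q x ∈ J := by
  induction x using AddMonoidAlgebra.induction_linear with
  | zero => simp
  | add f g hf hg =>
    rw [map_add, add_sub_add_comm]; exact J.add_mem hf hg
  | single u a =>
    rw [mapExp_single, LR_single_eq, LR_single_eq, ← mul_sub]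
    refine J.mul_mem_left _ ?_
    have : tm u - tm (q u) = tm (q u) * (tm (u - q u) - 1) := by
      rw [mul_sub, ← tm_add]; simp
    rw [this]
    exact J.mul_mem_left _ (tm_sub_one_mem J s hs _ (hq u))

/-- the generators of the augmentation ideal -/
noncomputable def fv (n : ℕ) : Fin n → LR n := fun i => tm (Pi.single i 1) - 1

@[simp] theorem aug_fv (n : ℕ) (i) : aug n (fv n i) = 0 := by simp [fv]

theorem closure_single (n : ℕ) (v : Fin n → ℤ) :
    v ∈ AddSubgroup.closure (Set.range fun i : Fin n => (Pi.single i 1 : Fin n → ℤ)) := by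
  have : v = ∑ i, v i • (Pi.single i 1 : Fin n → ℤ) := by
    ext j; simp [Finset.sum_apply, Pi.single_apply]
  rw [this]
  exact AddSubgroup.sum_mem _ fun i _ =>
    AddSubgroup.zsmul_mem _ (AddSubgroup.subset_closure (Set.mem_range_self i)) _

theorem mapExp_zero {n m : ℕ} (x : LR n) : mapExp (0 : _ →+ (Fin m → ℤ)) x = (aug n x : LR m) := by
  induction x using AddMonoidAlgebra.induction_linear with
  | zero => simp
  | add f g hf hg => simp [hf, hg]
  | single u a => simp [LR_single_eq]

theorem mem_span_fv {n : ℕ} (x : LR n) (h : aug n x = 0) : x ∈ Ideal.span (Set.range (fv n)) := by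
  have := sub_mapExp_mem (0 : (Fin n → ℤ) →+ (Fin n → ℤ)) (Ideal.span (Set.range (fv n)))
    (Set.range fun i : Fin n => (Pi.single i 1 : Fin n → ℤ))
    (by rintro _ ⟨i, rfl⟩; exact Ideal.subset_span ⟨i, rfl⟩)
    (fun v => by simpa using closure_single n v) x
  rw [mapExp_zero, h] at this
  simpa using this

theorem span_fv (n : ℕ) : Ideal.span (Set.range (fv n)) = RingHom.ker (aug n) := by
  refine le_antisymm ?_ (fun x hx => mem_span_fv x hx)
  rw [Ideal.span_le]
  rintro _ ⟨i, rfl⟩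
  simp [RingHom.mem_ker]

/-- derivations at the augmentation -/
noncomputable def der {n : ℕ} (φ : (Fin n → ℤ) →+ ℤ) : LR n →+ ℤ where
  toFun x := x.coeff.sum fun v a => a * φ v
  map_zero' := by simp
  map_add' x y := by
    rw [AddMonoidAlgebra.coeff_add]
    exact Finsupp.sum_add_index' (by simp) (by intros; ring)

@[simp] theorem der_single {n : ℕ} (φ : (Fin n → ℤ) →+ ℤ) (v a) :
    der φ (.single v a) = a * φ v := by
  change (AddMonoidAlgebra.single v a : LR n).coeff.sum (fun v a => a * φ v) = a * φ v
  simp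

@[simp] theorem der_tm {n : ℕ} (φ : (Fin n → ℤ) →+ ℤ) (v) : der φ (tm v) = φ v := by
  simp [tm]

@[simp] theorem der_one {n : ℕ} (φ : (Fin n → ℤ) →+ ℤ) : der φ 1 = 0 := by
  rw [← tm_zero, der_tm, map_zero]

theorem der_mul {n : ℕ} (φ : (Fin n → ℤ) →+ ℤ) (x y : LR n) :
    der φ (x * y) = aug n x * der φ y + der φ x * aug n y := by
  induction x using AddMonoidAlgebra.induction_linear with
  | zero => simp
  | add f g hf hg => simp only [add_mul, map_add, hf, hg]; ring
  | single u a =>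
    induction y using AddMonoidAlgebra.induction_linear with
    | zero => simp
    | add f g hf hg => simp only [mul_add, map_add, hf, hg]; ring
    | single v b =>
      simp only [AddMonoidAlgebra.single_mul_single, der_single, aug_single, map_add]; ring

theorem der_mapExp {m n : ℕ} (φ : (Fin n → ℤ) →+ ℤ) (p : (Fin m → ℤ) →+ (Fin n → ℤ)) (x : LR m) :
    der φ (mapExp p x) = der (φ.comp p) x := by
  induction x using AddMonoidAlgebra.induction_linear with
  | zero => simp
  | add f g hf hg => simp only [map_add, hf, hg]
  | single u a => simp

/-- Conjugation by a diagonal matrix. -/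
theorem conj_diag {R : Type*} [CommRing R] [IsDomain R] {α β : Type*} [Fintype α] [Fintype β]
    [DecidableEq α] [DecidableEq β] (T : R) (hT : T ≠ 0) (e e' : α ⊕ β → R)
    (M : Matrix (α ⊕ β) (α ⊕ β) R) (hM : IsUnit M) (he : M *ᵥ e = e')
    (hd : ∀ i j, T ∣ M (Sum.inl i) (Sum.inr j)) :
    UEquiv (Sum.elim (fun i => e (Sum.inl i)) fun j => T * e (Sum.inr j))
      (Sum.elim (fun i => e' (Sum.inl i)) fun j => T * e' (Sum.inr j)) := by
  choose B hB using hd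
  let M' : Matrix (α ⊕ β) (α ⊕ β) R :=
    fromBlocks M.toBlocks₁₁ (Matrix.of B) (T • M.toBlocks₂₁) M.toBlocks₂₂
  let D : Matrix (α ⊕ β) (α ⊕ β) R := Matrix.diagonal (Sum.elim (fun _ => 1) fun _ => T)
  have hD : D.det ≠ 0 := by
    simp only [D, det_diagonal, Fintype.prod_sum_type]
    simpa using pow_ne_zero _ hT
  have hMD : M' * D = D * M := by
    ext i j
    rw [mul_diagonal, diagonal_mul]
    rcases i with i | i <;> rcases j with j | j
    · simp [M', toBlocks₁₁]
    · simp [M', hB, mul_comm]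
    · simp [M', toBlocks₂₁]
    · simp [M', toBlocks₂₂, mul_comm]
  refine ⟨M', ?_, ?_⟩
  · rw [Matrix.isUnit_iff_isUnit_det] at hM ⊢
    have := congrArg det hMD
    rw [det_mul, det_mul, mul_comm] at this
    rw [mul_left_cancel₀ hD this]
    exact hM
  · have h1 : ∀ e : α ⊕ β → R,
        (Sum.elim (fun i => e (Sum.inl i)) fun j => T * e (Sum.inr j)) = D *ᵥ e := by
      intro e
      ext i
      rw [mulVec_diagonal]
      rcases i with i | i <;> simp
    rw [h1, h1, mulVec_mulVec, hMD, ← mulVec_mulVec, he]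

theorem tail_fv_cons {n : ℕ} (i : Fin n) : mapExp (consHom n) (fv n i) = fv (n + 1) i.succ := by
  simp only [fv, map_sub, mapExp_tm, map_one]
  congr 2
  ext j
  refine Fin.cases ?_ (fun j => ?_) j
  · simp [consHom]
  · simp [consHom, Pi.single_apply]

theorem T_ne {n : ℕ} : fv (n + 1) 0 ≠ 0 := by
  intro h
  have := congrArg (der (Pi.evalAddMonoidHom (fun _ : Fin (n+1) => ℤ) 0)) h
  simp [fv] at this

/-- The retraction killing the first coordinate. -/
noncomputable def sr (n : ℕ) : LR (n + 1) →+* LR (n + 1) :=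
  (mapExp (consHom n)).comp (mapExp (tailHom n))

theorem sr_eq {n : ℕ} (x) : sr n x = mapExp (consHom n) (mapExp (tailHom n) x) := rfl

theorem sr_sr {n : ℕ} (x) : sr n (sr n x) = sr n x := by
  simp [sr_eq, tail_cons_exp]

theorem T_dvd_sub {n : ℕ} (x : LR (n + 1)) : fv (n + 1) 0 ∣ x - sr n x := by
  rw [← Ideal.mem_span_singleton]
  rw [sr_eq, mapExp_comp]
  refine sub_mapExp_mem _ _ {Pi.single 0 1} ?_ ?_ x
  · rintro _ rfl
    exact Ideal.subset_span rfl
  · intro v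
    have : v - ((consHom n).comp (tailHom n)) v = v 0 • (Pi.single 0 1 : Fin (n+1) → ℤ) := by
      ext j
      refine Fin.cases ?_ (fun j => ?_) j
      · simp [consHom, tailHom]
      · have : v j.succ - v j.succ = v 0 • (Pi.single 0 1 : Fin (n+1) → ℤ) j.succ := by simp
        exact this
    rw [this]
    exact AddSubgroup.zsmul_mem _ (AddSubgroup.subset_closure (Set.mem_singleton _)) _

theorem aug_sr {n : ℕ} (x) : aug (n+1) (sr n x) = aug (n+1) x := by
  simp [sr_eq, aug_mapExp]

/-- Special completion. -/
theorem unimod_special {n : ℕ} {ι : Type} [Fintype ι] [DecidableEq ι] (e : ι → LR (n + 1))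
    (he : Unimod e) : ∃ M : Matrix ι ι (LR (n + 1)), IsUnit M ∧
      M *ᵥ e = (fun i => sr n (e i)) ∧ ∀ i j, i ≠ j → fv (n + 1) 0 ∣ M i j := by
  by_cases hι : Nonempty ι
  swap
  · have : IsEmpty ι := not_nonempty_iff.1 hι
    exact ⟨1, isUnit_one, by ext i; exact isEmptyElim i, fun i => isEmptyElim i⟩
  obtain ⟨i₀⟩ := hι
  obtain ⟨N, hN, hNe⟩ := herm_LR (n + 1) ι i₀ e he
  let N1 := (sr n).mapMatrix N
  have hN1 : IsUnit N1 := hN.map (sr n).mapMatrix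
  have hN1e : N1 *ᵥ (fun i => sr n (e i)) = Pi.single i₀ 1 := by
    have : N1 *ᵥ (fun i => sr n (e i)) = fun i => sr n ((N *ᵥ e) i) := by
      ext1 i; simp [N1, mulVec, dotProduct]
    rw [this, hNe]
    ext1 i
    by_cases h : i = i₀
    · subst h; simp
    · simp [h]
  obtain ⟨W, hW⟩ := hN1
  let Wi : Matrix ι ι (LR (n + 1)) := ((W⁻¹ : (Matrix ι ι (LR (n+1)))ˣ) : Matrix ι ι (LR (n+1)))
  have hWi : Wi * N1 = 1 := by rw [← hW]; exact W.inv_mul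
  have hWi2 : N1 * Wi = 1 := by rw [← hW]; exact W.mul_inv
  refine ⟨Wi * N, (Units.isUnit _).mul hN, ?_, ?_⟩
  · rw [← mulVec_mulVec, hNe, ← hN1e, mulVec_mulVec, hWi, one_mulVec]
  · have hs : (sr n).mapMatrix (Wi * N) = 1 := by
      have h1 : (sr n).mapMatrix N1 = N1 := by
        ext i j; simp [N1, sr_sr]
      have h2 : (sr n).mapMatrix Wi = Wi := by
        have h3 : (sr n).mapMatrix Wi * N1 = 1 := by
          rw [← h1, ← map_mul, hWi, map_one]
        calc (sr n).mapMatrix Wi = (sr n).mapMatrix Wi * (N1 * Wi) := by rw [hWi2, mul_one]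
          _ = Wi := by rw [← mul_assoc, h3, one_mul]
      rw [map_mul, h2]
      exact hWi
    intro i j hij
    have := T_dvd_sub ((Wi * N) i j)
    have h4 : sr n ((Wi * N) i j) = 0 := by
      have := congrFun (congrFun hs i) j
      simpa [Matrix.one_apply_ne hij] using this
    rwa [h4, sub_zero] at this

theorem thmE_core {n : ℕ} {κ : Type} [Fintype κ] [DecidableEq κ] (k₀ : κ)
    (IH : ∀ g : Fin n ⊕ κ → LR n, Ideal.span (Set.range g) = RingHom.ker (aug n) →
      UEquiv g (Sum.elim (fv n) 0))
    (g : Fin n ⊕ κ → LR (n + 1)) (hg : Ideal.span (Set.range g) = RingHom.ker (aug (n + 1))) :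
    UEquiv g (Sum.elim (fun i => fv (n + 1) i.succ) (Pi.single k₀ (fv (n + 1) 0))) := by
  have hg1 : Ideal.span (Set.range fun i => mapExp (tailHom n) (g i)) = RingHom.ker (aug n) := by
    have : (Set.range fun i => mapExp (tailHom n) (g i)) = mapExp (tailHom n) '' Set.range g := by
      rw [← Set.range_comp]; rfl
    rw [this, ← Ideal.map_span, hg]
    refine le_antisymm ?_ ?_
    · rw [Ideal.map_le_iff_le_comap]
      intro x hx
      simpa [RingHom.mem_ker, aug_mapExp] using hx
    · intro x hx
      rw [← tail_cons_exp x]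
      refine Ideal.mem_map_of_mem _ ?_
      simpa [RingHom.mem_ker, aug_mapExp] using hx
  obtain ⟨V, hV, hVg⟩ := IH _ hg1
  let g2 := (mapExp (consHom n)).mapMatrix V *ᵥ g
  have hgg2 : UEquiv g g2 := ⟨_, hV.map (mapExp (consHom n)).mapMatrix, rfl⟩
  have htg2 : ∀ i, mapExp (tailHom n) (g2 i) = Sum.elim (fv n) 0 i := by
    intro i
    rw [← hVg]
    simp [g2, mulVec, dotProduct, tail_cons_exp]
  have hspan : Ideal.span (Set.range g2) = RingHom.ker (aug (n + 1)) := by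
    rw [← hgg2.span_eq, hg]
  clear_value g2
  refine hgg2.trans ?_
  clear hgg2 hVg hV hg1 hg IH V g
  set T := fv (n + 1) 0 with hTdef
  have hdiv : ∀ k, T ∣ g2 (Sum.inr k) := by
    intro k
    have := T_dvd_sub (g2 (Sum.inr k))
    rw [sr_eq, htg2] at this
    simpa using this
  choose h hh using hdiv
  have hsr : ∀ i, sr n (g2 (Sum.inl i)) = fv (n + 1) i.succ := by
    intro i
    rw [sr_eq, htg2, Sum.elim_inl, tail_fv_cons]
  have haug : Unimod (fun k => aug (n + 1) (h k)) ∧ Unimod (Sum.elim (fun i => g2 (Sum.inl i)) h) := by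
    have hT : T ∈ Ideal.span (Set.range g2) := by
      rw [hspan, RingHom.mem_ker, hTdef, aug_fv]
    rw [Ideal.mem_span_range_iff_exists_fun] at hT
    obtain ⟨c, hc⟩ := hT
    rw [Fintype.sum_sum_type] at hc
    have haT : aug (n + 1) T = 0 := aug_fv _ _
    have hag : ∀ i, aug (n+1) (g2 i) = 0 := by
      intro i
      have : g2 i ∈ RingHom.ker (aug (n + 1)) := by
        rw [← hspan]; exact Ideal.subset_span ⟨i, rfl⟩
      exact this
    have hcj : ∀ j : Fin n, aug (n + 1) (c (Sum.inl j)) = 0 := by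
      intro j
      let φ := Pi.evalAddMonoidHom (fun _ : Fin (n+1) => ℤ) j.succ
      have := congrArg (der φ) hc
      have hdT : der φ T = 0 := by
        simp [hTdef, fv, φ, Pi.single_apply]
      have hdg : ∀ i, der φ (g2 (Sum.inl i)) = if i = j then 1 else 0 := by
        intro i
        have h1 : der φ (g2 (Sum.inl i)) = der φ (sr n (g2 (Sum.inl i))) := by
          rw [sr_eq, der_mapExp, der_mapExp]
          rfl
        rw [h1, hsr]
        simp [fv, φ, Pi.single_apply, eq_comm]
      simp only [map_add, map_sum, map_mul, der_mul, hh, hag, hdT, haT, hdg] at this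
      simpa using this
    let φ := Pi.evalAddMonoidHom (fun _ : Fin (n+1) => ℤ) 0
    have h1 := congrArg (der φ) hc
    have hdT : der φ T = 1 := by
      simp [hTdef, fv, φ]
    simp only [map_add, map_sum, map_mul, der_mul, hh, hag, hdT, haT, hcj] at h1
    have h2 : ∑ k, aug (n + 1) (c (Sum.inr k)) * aug (n + 1) (h k) = 1 := by simpa using h1
    refine ⟨⟨_, h2⟩, ?_⟩
    rw [unimod_iff, Ideal.eq_top_iff_one]
    set J := Ideal.span (Set.range (Sum.elim (fun i => g2 (Sum.inl i)) h)) with hJ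
    have hhJ : ∀ k, h k ∈ J := fun k => Ideal.subset_span ⟨Sum.inr k, rfl⟩
    have hkJ : RingHom.ker (aug (n + 1)) ≤ J := by
      rw [← hspan, Ideal.span_le]
      rintro _ ⟨i | k, rfl⟩
      · exact Ideal.subset_span ⟨Sum.inl i, rfl⟩
      · rw [hh]
        exact J.mul_mem_left _ (hhJ k)
    have h3 : ∑ k, c (Sum.inr k) * h k ∈ J := J.sum_mem fun k _ => J.mul_mem_left _ (hhJ k)
    have h4 : ∑ k, c (Sum.inr k) * h k - 1 ∈ J := hkJ (by
      rw [RingHom.mem_ker, map_sub, map_sum, map_one]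
      simp only [map_mul, h2, sub_self])
    have := J.sub_mem h3 h4
    simpa using this
  obtain ⟨ha, hu⟩ := haug
  obtain ⟨M, hM, hMe, hMd⟩ := unimod_special _ hu
  have s1 := conj_diag T T_ne _ _ M hM hMe (fun i j => hMd _ _ (by simp))
  have e1 : (Sum.elim (fun i => (Sum.elim (fun i => g2 (Sum.inl i)) h : Fin n ⊕ κ → LR (n+1)) (Sum.inl i))
      fun j => T * (Sum.elim (fun i => g2 (Sum.inl i)) h : Fin n ⊕ κ → LR (n+1)) (Sum.inr j)) = g2 := by
    ext1 i
    rcases i with i | i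
    · simp
    · simp [hh]
  rw [e1] at s1
  refine s1.trans ?_
  simp only [Sum.elim_inl, Sum.elim_inr, hsr]
  obtain ⟨W, hW, hWe⟩ := herm_int κ k₀ _ ha
  let W' := (Int.castRingHom (LR (n + 1))).mapMatrix W
  let w := W' *ᵥ (fun k => sr n (h k))
  have hw1 : ∀ k, sr n (w k) = w k := by
    intro k
    simp [w, W', mulVec, dotProduct, sr_sr]
  have hw2 : ∀ k, aug (n + 1) (w k) = (Pi.single k₀ 1 : κ → ℤ) k := by
    intro k
    rw [← hWe]
    simp [w, W', mulVec, dotProduct, aug_sr]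
  have s2 : UEquiv (fun k => T * sr n (h k)) (fun k => T * w k) := by
    refine ⟨W', hW.map (Int.castRingHom (LR (n + 1))).mapMatrix, ?_⟩
    ext1 k
    simp only [w, mulVec, dotProduct, Finset.mul_sum]
    exact Finset.sum_congr rfl fun i _ => by ring
  refine ((UEquiv.refl _).sum s2).trans ?_
  refine UEquiv.elem (Set.range Sum.inl) ?_ ?_
  · rintro _ ⟨i, rfl⟩; rfl
  · rintro (i | k) hi
    · exact absurd ⟨i, rfl⟩ hi
    have e2 : (Pi.single k₀ T : κ → LR (n+1)) k = T * ((Pi.single k₀ 1 : κ → ℤ) k : ℤ) := by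
      by_cases hk : k = k₀
      · subst hk; simp
      · simp [hk]
    simp only [Sum.elim_inr, e2, ← mul_sub]
    refine Ideal.mul_mem_left _ _ ?_
    set x := (((Pi.single k₀ 1 : κ → ℤ) k : ℤ) : LR (n+1)) - w k with hx
    have hx1 : sr n x = x := by simp [hx, hw1]
    have hx2 : aug (n + 1) x = 0 := by simp [hx, hw2]
    have hx3 := mem_span_fv (mapExp (tailHom n) x) (by rw [aug_mapExp, hx2])
    have hx4 := Ideal.mem_map_of_mem (mapExp (consHom n)) hx3
    rw [← sr_eq, hx1, Ideal.map_span] at hx4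
    refine Ideal.span_mono ?_ hx4
    rintro _ ⟨_, ⟨i, rfl⟩, rfl⟩
    exact ⟨Sum.inl i, ⟨i, rfl⟩, by rw [tail_fv_cons]; rfl⟩

/-- Generators of the augmentation ideal are unique up to equivalence. -/
theorem thmE : ∀ (n : ℕ) (κ : Type) [Fintype κ] [DecidableEq κ] (g : Fin n ⊕ κ → LR n),
    Ideal.span (Set.range g) = RingHom.ker (aug n) → UEquiv g (Sum.elim (fv n) 0) := by
  intro n
  induction n with
  | zero =>
    intro κ _ _ g hg
    have : g = (Sum.elim (fv 0) 0) := by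
      rw [← span_fv, Set.range_eq_empty (fv 0), Ideal.span_empty] at hg
      ext1 i
      have : g i ∈ Ideal.span (Set.range g) := Ideal.subset_span ⟨i, rfl⟩
      rw [hg, Ideal.mem_bot] at this
      rw [this]
      rcases i with i | i
      · exact i.elim0
      · rfl
    rw [this]
    exact UEquiv.refl _
  | succ n ih =>
    intro κ _ _ g hg
    let e : Fin n ⊕ Option κ ≃ Fin (n + 1) ⊕ κ :=
      { toFun := Sum.elim (fun i => Sum.inl i.succ) (fun o => o.elim (Sum.inl 0) Sum.inr)
        invFun := Sum.elim (fun i => Fin.cases (Sum.inr none) Sum.inl i) (fun k => Sum.inr (some k))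
        left_inv := by rintro (i | (_ | k)) <;> simp
        right_inv := by
          rintro (i | k)
          · refine Fin.cases ?_ (fun i => ?_) i <;> simp
          · simp }
    refine UEquiv.of_reindex e ?_
    have := thmE_core (none : Option κ) (ih (Option κ)) (g ∘ e)
      (by rw [Set.range_comp, e.range_eq_univ, Set.image_univ, hg])
    convert this using 1
    ext1 i
    rcases i with i | (_ | k) <;> simp [e]

end FM

set_option linter.unusedSectionVars false

namespace FM
open Matrix

theorem herm_complete {R : Type} [CommRing R] [Nontrivial R] (hR : Herm R) : ∀ (k : ℕ) (ι : Type)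
    [Fintype ι] [DecidableEq ι] (U : Matrix (Fin k) ι R) (Y : Matrix ι (Fin k) R), U * Y = 1 →
    ∃ (n : ℕ) (W : Matrix (Fin k ⊕ Fin n) ι R) (W' : Matrix ι (Fin k ⊕ Fin n) R),
      W * W' = 1 ∧ W' * W = 1 ∧ ∀ i j, W (Sum.inl i) j = U i j := by
  intro k
  induction k with
  | zero =>
    intro ι _ _ U Y _
    let e : Fin 0 ⊕ Fin (Fintype.card ι) ≃ ι :=
      (Equiv.emptySum _ _).trans (Fintype.equivFin ι).symm
    refine ⟨_, (1 : Matrix ι ι R).submatrix e id, (1 : Matrix ι ι R).submatrix id e, ?_, ?_, ?_⟩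
    · have := Matrix.submatrix_mul_equiv (1 : Matrix ι ι R) (1 : Matrix ι ι R) e (Equiv.refl ι) e
      rw [mul_one, Matrix.submatrix_one_equiv] at this
      exact this
    · rw [Matrix.submatrix_mul_equiv (1 : Matrix ι ι R) (1 : Matrix ι ι R) id e id]
      simp
    · intro i; exact i.elim0
  | succ k ih =>
    intro ι _ _ U Y hUY
    have hu : Unimod (U 0) := by
      refine ⟨fun j => Y j 0, ?_⟩
      have := congrFun (congrFun hUY 0) 0
      rw [mul_apply] at this
      simpa [mul_comm] using this
    have hne : Nonempty ι := by
      by_contra h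
      have : IsEmpty ι := not_nonempty_iff.1 h
      obtain ⟨c, hc⟩ := hu
      simp at hc
    obtain ⟨i0⟩ := hne
    obtain ⟨V, hV, hVu⟩ := hR ι i0 _ hu
    obtain ⟨Vu, hVu'⟩ : IsUnit Vᵀ := by
      rw [Matrix.isUnit_iff_isUnit_det] at hV ⊢; rwa [det_transpose]
    let Vi : Matrix ι ι R := ((Vu⁻¹ : (Matrix ι ι R)ˣ) : Matrix ι ι R)
    have hVi : Vᵀ * Vi = 1 := by rw [← hVu']; exact Vu.mul_inv
    have hVi2 : Vi * Vᵀ = 1 := by rw [← hVu']; exact Vu.inv_mul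
    let U1 := U * Vᵀ
    let Y1 := Vi * Y
    have hUY1 : U1 * Y1 = 1 := by
      simp only [U1, Y1]
      rw [Matrix.mul_assoc, ← Matrix.mul_assoc Vᵀ, hVi, Matrix.one_mul, hUY]
    have hrow : ∀ j, U1 0 j = (Pi.single i0 1 : ι → R) j := by
      intro j
      rw [← hVu]
      simp [U1, mul_apply, mulVec, dotProduct, mul_comm]
    have hY0 : ∀ j : Fin k, Y1 i0 j.succ = 0 := by
      intro j
      have := congrFun (congrFun hUY1 0) j.succ
      rw [mul_apply] at this
      simpa [hrow, Pi.single_apply, Matrix.one_apply, (Fin.succ_ne_zero j).symm] using this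
    let U2 : Matrix (Fin k) {j // j ≠ i0} R := Matrix.of fun i j => U1 i.succ j
    let Y2 : Matrix {j // j ≠ i0} (Fin k) R := Matrix.of fun i j => Y1 i j.succ
    have hUY2 : U2 * Y2 = 1 := by
      ext i j
      have := congrFun (congrFun hUY1 i.succ) j.succ
      rw [mul_apply, Fintype.sum_eq_add_sum_subtype_ne _ i0, hY0, mul_zero, zero_add] at this
      rw [mul_apply]
      simp only [U2, Y2, Matrix.of_apply]
      rw [this]
      simp [Matrix.one_apply]
    obtain ⟨n, W2, W2', h1, h2, h3⟩ := ih _ U2 Y2 hUY2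
    let a : Matrix (Fin k ⊕ Fin n) Unit R :=
      Matrix.of fun i _ => Sum.elim (fun i : Fin k => U1 i.succ i0) 0 i
    let M : Matrix (Unit ⊕ (Fin k ⊕ Fin n)) (Unit ⊕ {j // j ≠ i0}) R := fromBlocks 1 0 a W2
    let M' : Matrix (Unit ⊕ {j // j ≠ i0}) (Unit ⊕ (Fin k ⊕ Fin n)) R :=
      fromBlocks 1 0 (-(W2' * a)) W2'
    have hMM : M * M' = 1 := by
      simp only [M, M', fromBlocks_multiply]
      rw [← fromBlocks_one, h1, Matrix.mul_neg W2, ← Matrix.mul_assoc W2, h1]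
      simp
    have hMM' : M' * M = 1 := by
      simp only [M, M', fromBlocks_multiply]
      rw [← fromBlocks_one, h2]
      simp
    let e1 : Fin (k + 1) ⊕ Fin n ≃ Unit ⊕ (Fin k ⊕ Fin n) :=
      { toFun := Sum.elim (fun i => Fin.cases (Sum.inl ()) (fun i => Sum.inr (Sum.inl i)) i)
          (fun j => Sum.inr (Sum.inr j))
        invFun := Sum.elim (fun _ => Sum.inl 0)
          (Sum.elim (fun i => Sum.inl i.succ) (fun j => Sum.inr j))
        left_inv := by
          rintro (i | k)
          · refine Fin.cases ?_ (fun i => ?_) i <;> simp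
          · simp
        right_inv := by rintro (i | (i | k)) <;> simp }
    let e2 : ι ≃ Unit ⊕ {j // j ≠ i0} :=
      { toFun := fun j => if h : j = i0 then Sum.inl () else Sum.inr ⟨j, h⟩
        invFun := Sum.elim (fun _ => i0) Subtype.val
        left_inv := by
          intro j
          by_cases h : j = i0
          · simp [h]
          · simp [h]
        right_inv := by
          rintro (i | ⟨j, hj⟩)
          · simp
          · simp [hj] }
    let W1 := M.submatrix e1 e2
    let W1' := M'.submatrix e2 e1
    have hW1 : W1 * W1' = 1 := by
      simp only [W1, W1']
      rw [Matrix.submatrix_mul_equiv, hMM, Matrix.submatrix_one_equiv]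
    have hW1' : W1' * W1 = 1 := by
      simp only [W1, W1']
      rw [Matrix.submatrix_mul_equiv, hMM', Matrix.submatrix_one_equiv]
    have hW1U : ∀ i j, W1 (Sum.inl i) j = U1 i j := by
      intro i j
      refine Fin.cases ?_ (fun i => ?_) i
      · rw [hrow]
        by_cases h : j = i0
        · simp [W1, e1, e2, M, h]
        · simp [W1, e1, e2, M, h]
      · by_cases h : j = i0
        · simp [W1, e1, e2, M, a, h]
        · simp [W1, e1, e2, M, h, h3, U2]
    refine ⟨n, W1 * Vi, Vᵀ * W1', ?_, ?_, ?_⟩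
    · rw [Matrix.mul_assoc, ← Matrix.mul_assoc Vi, hVi2, Matrix.one_mul, hW1]
    · rw [Matrix.mul_assoc, ← Matrix.mul_assoc W1', hW1', Matrix.one_mul, hVi]
    · intro i j
      have : U = U1 * Vi := by
        simp only [U1]; rw [Matrix.mul_assoc, hVi, Matrix.mul_one]
      rw [this, mul_apply, mul_apply]
      simp only [hW1U]

theorem aug_row {l : ℕ} (u : Fin l → LR l) (b : Fin l → ℤ) (h : u ⬝ᵥ fv l = tm b - 1) (j : Fin l) :
    aug l (u j) = b j := by
  let φ := Pi.evalAddMonoidHom (fun _ : Fin l => ℤ) j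
  have := congrArg (der φ) h
  have hd : ∀ m, der φ (fv l m) = if m = j then 1 else 0 := by
    intro m; simp [fv, φ, Pi.single_apply, eq_comm]
  simp only [dotProduct, map_sum, der_mul, aug_fv, hd, map_sub, der_tm, der_one] at this
  simpa [φ] using this

theorem completion (l k : ℕ) (U : Matrix (Fin k) (Fin l) (LR l)) (Y : Matrix (Fin l) (Fin k) (LR l))
    (hUY : U * Y = 1) (b : Fin k → Fin l → ℤ) (hb : ∀ i, U i ⬝ᵥ fv l = tm (b i) - 1) :
    ∃ (n : ℕ) (W : Matrix (Fin k ⊕ Fin n) (Fin l) (LR l)) (W' : Matrix (Fin l) (Fin k ⊕ Fin n) (LR l))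
      (b' : Fin k ⊕ Fin n → Fin l → ℤ), W * W' = 1 ∧ W' * W = 1 ∧
      (∀ i, W (Sum.inl i) = U i) ∧ ∀ c, W c ⬝ᵥ fv l = tm (b' c) - 1 := by
  obtain ⟨n, W0, W0', h1, h2, h3⟩ := herm_complete (herm_LR l) k (Fin l) U Y hUY
  let Bm : Matrix (Fin k ⊕ Fin n) (Fin l) ℤ := W0.map (aug l)
  let Bi : Matrix (Fin l) (Fin k ⊕ Fin n) ℤ := W0'.map (aug l)
  have hB1 : Bm * Bi = 1 := by
    have := congrArg (fun M : Matrix _ _ (LR l) => M.map (aug l)) h1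
    simpa [Bm, Bi, Matrix.map_mul] using this
  have hB2 : Bi * Bm = 1 := by
    have := congrArg (fun M : Matrix _ _ (LR l) => M.map (aug l)) h2
    simpa [Bm, Bi, Matrix.map_mul] using this
  have hBb : ∀ i, Bm (Sum.inl i) = b i := by
    intro i
    ext j
    simp only [Bm, map_apply, h3]
    exact aug_row _ _ (hb i) j
  let p : (Fin l → ℤ) →+ (Fin n → ℤ) :=
    { toFun := fun v j => (v ᵥ* Bi) (Sum.inr j)
      map_zero' := by ext j; simp
      map_add' := by intro u v; ext j; simp [add_vecMul] }
  let σ : (Fin n → ℤ) →+ (Fin l → ℤ) :=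
    { toFun := fun y => (Sum.elim (0 : Fin k → ℤ) y) ᵥ* Bm
      map_zero' := by
        have : (Sum.elim (0 : Fin k → ℤ) (0 : Fin n → ℤ)) = 0 := by
          ext i; rcases i with i | i <;> simp
        rw [this]; simp
      map_add' := by
        intro u v
        rw [← add_vecMul]
        congr 1
        ext i; rcases i with i | i <;> simp }
  have hpσ : ∀ y, p (σ y) = y := by
    intro y
    change (fun j => (((Sum.elim (0 : Fin k → ℤ) y) ᵥ* Bm) ᵥ* Bi) (Sum.inr j)) = y
    rw [vecMul_vecMul, hB1, vecMul_one]
    rfl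
  have hpσ' : p.comp σ = AddMonoidHom.id _ := AddMonoidHom.ext hpσ
  have hBv : ∀ c, Bm c ᵥ* Bi = Pi.single c 1 := by
    intro c
    ext d
    have := congrFun (congrFun hB1 c) d
    rw [mul_apply] at this
    simp only [vecMul, dotProduct, this, Matrix.one_apply, Pi.single_apply, eq_comm]
  have hpb : ∀ i, p (b i) = 0 := by
    intro i
    rw [← hBb]
    change (fun j => (Bm (Sum.inl i) ᵥ* Bi) (Sum.inr j)) = 0
    rw [hBv]
    ext j; simp
  have hclo : ∀ v, v - (σ.comp p) v ∈ AddSubgroup.closure (Set.range b) := by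
    intro v
    have : v - (σ.comp p) v = ∑ i, (v ᵥ* Bi) (Sum.inl i) • b i := by
      have e1 : v = (v ᵥ* Bi) ᵥ* Bm := by rw [vecMul_vecMul, hB2, vecMul_one]
      have e2 : (σ.comp p) v = (Sum.elim (0 : Fin k → ℤ) (fun j => (v ᵥ* Bi) (Sum.inr j))) ᵥ* Bm := rfl
      rw [e2]
      conv_lhs => lhs; rw [e1]
      generalize v ᵥ* Bi = y
      ext j
      simp only [Pi.sub_apply, vecMul, dotProduct, Fintype.sum_sum_type, ← hBb, Finset.sum_apply,
        Pi.smul_apply, smul_eq_mul, Sum.elim_inl, Sum.elim_inr, Pi.zero_apply, zero_mul,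
        Finset.sum_const_zero, zero_add, add_sub_cancel_right]
    rw [this]
    exact AddSubgroup.sum_mem _ fun i _ =>
      AddSubgroup.zsmul_mem _ (AddSubgroup.subset_closure (Set.mem_range_self i)) _
  clear_value p σ
  have hρσ : ∀ x, mapExp p (mapExp σ x) = x := by
    intro x; rw [mapExp_comp, hpσ', mapExp_id]
  have hρU : ∀ i, mapExp p (W0 (Sum.inl i) ⬝ᵥ fv l) = 0 := by
    intro i
    have : W0 (Sum.inl i) = U i := funext (h3 i)
    rw [this, hb]; simp [hpb]
  let g : Fin n → LR n := fun j => mapExp p (W0 (Sum.inr j) ⬝ᵥ fv l)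
  have hspanW : Ideal.span (Set.range (W0 *ᵥ fv l)) = RingHom.ker (aug l) := by
    rw [← span_fv]
    refine le_antisymm ?_ ?_
    · rw [Ideal.span_le]
      rintro _ ⟨i, rfl⟩
      change ∑ j, W0 i j * fv l j ∈ Ideal.span (Set.range (fv l))
      exact Ideal.sum_mem _ fun j _ => Ideal.mul_mem_left _ _ (Ideal.subset_span (Set.mem_range_self j))
    · rw [Ideal.span_le]
      rintro _ ⟨i, rfl⟩
      have : fv l = W0' *ᵥ (W0 *ᵥ fv l) := by rw [mulVec_mulVec, h2, one_mulVec]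
      have h4 : fv l i = ∑ j, W0' i j * (W0 *ᵥ fv l) j := congrFun this i
      change fv l i ∈ Ideal.span (Set.range (W0 *ᵥ fv l))
      rw [h4]
      exact Ideal.sum_mem _ fun j _ => Ideal.mul_mem_left _ _ (Ideal.subset_span (Set.mem_range_self j))
  have hg : Ideal.span (Set.range g) = RingHom.ker (aug n) := by
    have h4 : RingHom.ker (aug n) = Ideal.map (mapExp p) (RingHom.ker (aug l)) := by
      refine le_antisymm ?_ ?_
      · intro x hx
        rw [← hρσ x]
        refine Ideal.mem_map_of_mem _ ?_
        simpa [RingHom.mem_ker, aug_mapExp] using hx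
      · rw [Ideal.map_le_iff_le_comap]
        intro x hx
        simpa [RingHom.mem_ker, aug_mapExp] using hx
    rw [h4, ← hspanW, Ideal.map_span]
    refine le_antisymm ?_ ?_
    · refine Ideal.span_mono ?_
      rintro _ ⟨j, rfl⟩
      exact ⟨_, ⟨Sum.inr j, rfl⟩, rfl⟩
    · rw [Ideal.span_le]
      rintro _ ⟨_, ⟨i | j, rfl⟩, rfl⟩
      · have := hρU i
        change mapExp p (W0 (Sum.inl i) ⬝ᵥ fv l) ∈ _
        rw [this]
        exact Ideal.zero_mem _
      · exact Ideal.subset_span ⟨j, rfl⟩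
  obtain ⟨V, hV, hVg⟩ : UEquiv g (fv n) := by
    let e : Fin n ⊕ Empty ≃ Fin n := Equiv.sumEmpty _ _
    refine UEquiv.of_reindex e ?_
    have := thmE n Empty (g ∘ e) (by rw [Set.range_comp, e.range_eq_univ, Set.image_univ, hg])
    convert this using 1
    ext1 i
    rcases i with i | i
    · rfl
    · exact i.elim
  let V' := (mapExp σ).mapMatrix V
  have hV' : IsUnit V' := hV.map (mapExp σ).mapMatrix
  let x : Fin n → LR l := fun j => ∑ m, V' j m * (W0 (Sum.inr m) ⬝ᵥ fv l)
  have hρx : ∀ j, mapExp p (x j) = fv n j := by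
    intro j
    rw [← hVg]
    simp [x, V', g, mulVec, dotProduct, hρσ]
  have hxm : ∀ j, x j - (tm (σ (Pi.single j 1)) - 1) ∈
      Ideal.span (Set.range fun i => tm (b i) - 1) := by
    intro j
    have := sub_mapExp_mem (σ.comp p) (Ideal.span (Set.range fun i => tm (b i) - 1)) (Set.range b)
      (by rintro _ ⟨i, rfl⟩; exact Ideal.subset_span ⟨i, rfl⟩) hclo (x j)
    rw [← mapExp_comp, hρx] at this
    simpa [fv] using this
  have hxc : ∀ j, ∃ c : Fin k → LR l, ∑ i, c i * (tm (b i) - 1) =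
      x j - (tm (σ (Pi.single j 1)) - 1) := by
    intro j
    exact Ideal.mem_span_range_iff_exists_fun.1 (hxm j)
  choose c hc using hxc
  let Q : Matrix (Fin k ⊕ Fin n) (Fin k ⊕ Fin n) (LR l) := fromBlocks 1 0 (-Matrix.of c) V'
  obtain ⟨Qu, hQu⟩ : IsUnit Q := by
    rw [Matrix.isUnit_iff_isUnit_det] at hV' ⊢
    simp only [Q]
    rw [det_fromBlocks_zero₁₂, det_one, one_mul]
    exact hV'
  let Qi : Matrix (Fin k ⊕ Fin n) (Fin k ⊕ Fin n) (LR l) := ((Qu⁻¹ : (Matrix _ _ (LR l))ˣ) : Matrix _ _ (LR l))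
  have hQ1 : Q * Qi = 1 := by rw [← hQu]; exact Qu.mul_inv
  have hQ2 : Qi * Q = 1 := by rw [← hQu]; exact Qu.inv_mul
  refine ⟨n, Q * W0, W0' * Qi, Sum.elim b (fun j => σ (Pi.single j 1)), ?_, ?_, ?_, ?_⟩
  · rw [Matrix.mul_assoc, ← Matrix.mul_assoc W0, h1, Matrix.one_mul, hQ1]
  · rw [Matrix.mul_assoc, ← Matrix.mul_assoc Qi, hQ2, Matrix.one_mul, h2]
  · intro i
    ext1 j
    simp only [mul_apply, Fintype.sum_sum_type, Q, h3, fromBlocks_apply₁₁, fromBlocks_apply₁₂]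
    simp [Matrix.one_apply]
  · intro d
    have hd : (Q * W0) d ⬝ᵥ fv l = (Q *ᵥ (W0 *ᵥ fv l)) d := by
      rw [mulVec_mulVec]; rfl
    rw [hd]
    have hl : ∀ i, (W0 *ᵥ fv l) (Sum.inl i) = tm (b i) - 1 := by
      intro i
      rw [← hb i]
      simp only [mulVec, dotProduct, h3]
    rcases d with i | j
    · simp only [mulVec, dotProduct, Fintype.sum_sum_type, Q, fromBlocks_apply₁₁,
        fromBlocks_apply₁₂, Sum.elim_inl]
      rw [← hl i]
      simp [Matrix.one_apply, mulVec, dotProduct]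
    · have h5 := hc j
      have h6 : (Q *ᵥ (W0 *ᵥ fv l)) (Sum.inr j) = - ∑ i, c j i * (tm (b i) - 1) + x j := by
        rw [mulVec, dotProduct, Fintype.sum_sum_type]
        simp only [hl, Q, fromBlocks_apply₂₁, fromBlocks_apply₂₂, x]
        simp [mulVec]
      rw [h6, h5, Sum.elim_inr]
      ring

end FM

set_option linter.unusedSectionVars false

namespace FM
open Matrix

/-- The Magnus group. -/
@[ext] structure Mag (l m : ℕ) where
  /-- the translation part -/
  vec : Fin m → LR l
  /-- the exponent part -/
  ex : Fin l → ℤ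

namespace Mag
variable {l m : ℕ}

noncomputable instance : Mul (Mag l m) := ⟨fun x y => ⟨x.vec + tm x.ex • y.vec, x.ex + y.ex⟩⟩
noncomputable instance : One (Mag l m) := ⟨⟨0, 0⟩⟩
noncomputable instance : Inv (Mag l m) := ⟨fun x => ⟨- (tm (-x.ex) • x.vec), -x.ex⟩⟩

@[simp] theorem mul_vec (x y : Mag l m) : (x * y).vec = x.vec + tm x.ex • y.vec := rfl
@[simp] theorem mul_ex (x y : Mag l m) : (x * y).ex = x.ex + y.ex := rfl
@[simp] theorem one_vec : (1 : Mag l m).vec = 0 := rfl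
@[simp] theorem one_ex : (1 : Mag l m).ex = 0 := rfl
@[simp] theorem inv_vec (x : Mag l m) : (x⁻¹).vec = - (tm (-x.ex) • x.vec) := rfl
@[simp] theorem inv_ex (x : Mag l m) : (x⁻¹).ex = - x.ex := rfl

noncomputable instance : Group (Mag l m) :=
  Group.ofLeftAxioms
    (by
      intro x y z
      ext1
      · simp [tm_add, smul_add, mul_smul, add_assoc]
      · simp [add_assoc])
    (by
      intro x
      ext1 <;> simp)
    (by
      intro x
      ext1 <;> simp)

theorem comm_of_ex (x y : Mag l m) (hx : x.ex = 0) (hy : y.ex = 0) : x * y = y * x := by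
  ext1
  · simp [hx, hy, add_comm]
  · simp [hx, hy]

/-- The exponent homomorphism. -/
noncomputable def exHom : Mag l m →* Multiplicative (Fin l → ℤ) where
  toFun x := Multiplicative.ofAdd x.ex
  map_one' := rfl
  map_mul' _ _ := rfl

end Mag

variable {l m : ℕ}

theorem ex_of_mem_derived {G : Type*} [Group G] (f : G →* Mag l m) (c : G)
    (hc : c ∈ derivedSeries G 1) : (f c).ex = 0 := by
  rw [derivedSeries_one] at hc
  have := Abelianization.commutator_subset_ker (Mag.exHom.comp f) hc
  rw [MonoidHom.mem_ker] at this
  exact this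

theorem mag_of_mem_derived {G : Type*} [Group G] (f : G →* Mag l m) (c : G)
    (hc : c ∈ derivedSeries G 2) : f c = 1 := by
  have h : derivedSeries G 2 ≤ f.ker := by
    rw [derivedSeries_succ, Subgroup.commutator_le]
    intro g hg h hh
    rw [MonoidHom.mem_ker, map_commutatorElement, commutatorElement_eq_one_iff_mul_comm]
    exact Mag.comm_of_ex _ _ (ex_of_mem_derived f g hg) (ex_of_mem_derived f h hh)
  exact h hc

/-- Magnus homomorphism with weights. -/
noncomputable def mag (q : Fin m → Fin l → ℤ) : FreeGroup (Fin m) →* Mag l m :=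
  FreeGroup.lift fun i => ⟨Pi.single i 1, q i⟩

@[simp] theorem mag_of (q : Fin m → Fin l → ℤ) (i) : mag q (FreeGroup.of i) = ⟨Pi.single i 1, q i⟩ := by
  simp [mag]

/-- linear extension -/
noncomputable def lin {M : Type*} [AddCommGroup M] (δ : (Fin l → ℤ) → M) : LR l →+ M where
  toFun x := x.coeff.sum fun v a => a • δ v
  map_zero' := by simp
  map_add' x y := by
    rw [AddMonoidAlgebra.coeff_add]
    exact Finsupp.sum_add_index' (by simp) (by intros; rw [add_smul])

theorem lin_single {M : Type*} [AddCommGroup M] (δ : (Fin l → ℤ) → M) (v) (a : ℤ) :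
    lin δ (.single v a) = a • δ v := by
  change (AddMonoidAlgebra.single v a : LR l).coeff.sum (fun v a => a • δ v) = a • δ v
  simp

theorem lin_tm {M : Type*} [AddCommGroup M] (δ : (Fin l → ℤ) → M) (v) :
    lin δ (tm v) = δ v := by
  rw [tm, lin_single, one_smul]

/-- Fox derivatives. -/
noncomputable def fD (x : FreeGroup (Fin l)) : Fin l → LR l := (mag (fun i => Pi.single i 1) x).vec

/-- Exponents. -/
noncomputable def fE (x : FreeGroup (Fin l)) : Fin l → ℤ := (mag (fun i => Pi.single i 1) x).ex

@[simp] theorem fD_one : fD (1 : FreeGroup (Fin l)) = 0 := by simp [fD]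
@[simp] theorem fE_one : fE (1 : FreeGroup (Fin l)) = 0 := by simp [fE]
@[simp] theorem fE_mul (x y : FreeGroup (Fin l)) : fE (x * y) = fE x + fE y := by simp [fE]
@[simp] theorem fE_inv (x : FreeGroup (Fin l)) : fE x⁻¹ = - fE x := by simp [fE]
theorem fD_mul (x y : FreeGroup (Fin l)) : fD (x * y) = fD x + tm (fE x) • fD y := by simp [fD, fE]
theorem fD_inv (x : FreeGroup (Fin l)) : fD x⁻¹ = - (tm (-fE x) • fD x) := by simp [fD, fE]
@[simp] theorem fD_of (i : Fin l) : fD (FreeGroup.of i) = Pi.single i 1 := by simp [fD]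
@[simp] theorem fE_of (i : Fin l) : fE (FreeGroup.of i) = Pi.single i 1 := by simp [fE]

theorem fD_mul_inv (x y : FreeGroup (Fin l)) (h : fE x = fE y) : fD (x * y⁻¹) = fD x - fD y := by
  rw [fD_mul, fD_inv, h, smul_neg, smul_smul, ← tm_add]
  simp [sub_eq_add_neg]

theorem fox (x : FreeGroup (Fin l)) : fD x ⬝ᵥ fv l = tm (fE x) - 1 := by
  induction x using FreeGroup.induction_on with
  | C1 => simp
  | of i => simp [fv]
  | inv_of i hi =>
    have hi : fD (FreeGroup.of i) ⬝ᵥ fv l = tm (fE (FreeGroup.of i)) - 1 := hi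
    change fD (FreeGroup.of i)⁻¹ ⬝ᵥ fv l = tm (fE (FreeGroup.of i)⁻¹) - 1
    rw [fD_inv, neg_dotProduct, smul_dotProduct, hi, smul_eq_mul, mul_sub, ← tm_add]
    simp
  | mul x y hx hy =>
    rw [fD_mul, add_dotProduct, smul_dotProduct, hx, hy, fE_mul, tm_add, smul_eq_mul]
    ring

theorem fE_surj_of {κ : Type*} (y : κ → FreeGroup (Fin l))
    (h : ∀ v, v ∈ AddSubgroup.closure (Set.range fun c => fE (y c))) (v : Fin l → ℤ) :
    ∃ x ∈ Subgroup.closure (Set.range y), fE x = v := by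
  have hv := h v
  induction hv using AddSubgroup.closure_induction with
  | mem x hx =>
    obtain ⟨c, rfl⟩ := hx
    exact ⟨y c, Subgroup.subset_closure ⟨c, rfl⟩, rfl⟩
  | zero => exact ⟨1, Subgroup.one_mem _, by simp⟩
  | add a b _ _ ha hb =>
    obtain ⟨x, hx, rfl⟩ := ha
    obtain ⟨y, hy, rfl⟩ := hb
    exact ⟨x * y, Subgroup.mul_mem _ hx hy, by simp⟩
  | neg a _ ha =>
    obtain ⟨x, hx, rfl⟩ := ha
    exact ⟨x⁻¹, Subgroup.inv_mem _ hx, by simp⟩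

theorem lemmaK {κ : Type*} [Fintype κ] (y : κ → FreeGroup (Fin l))
    (h : ∀ v : Fin l → ℤ, ∃ x ∈ Subgroup.closure (Set.range y), fE x = v) (z : κ → LR l)
    (hz : ∑ j, z j * (tm (fE (y j)) - 1) = 0) :
    ∃ x ∈ Subgroup.closure (Set.range y), fE x = 0 ∧ fD x = ∑ j, z j • fD (y j) := by
  choose s hs hsE using h
  set H := Subgroup.closure (Set.range y) with hH
  let N : AddSubgroup (Fin l → LR l) :=
    { carrier := {v | ∃ x ∈ H, fE x = 0 ∧ fD x = v}
      zero_mem' := ⟨1, H.one_mem, by simp, by simp⟩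
      add_mem' := by
        rintro _ _ ⟨x, hx, hx1, rfl⟩ ⟨y, hy, hy1, rfl⟩
        exact ⟨x * y, H.mul_mem hx hy, by simp [hx1, hy1], by simp [fD_mul, hx1]⟩
      neg_mem' := by
        rintro _ ⟨x, hx, hx1, rfl⟩
        exact ⟨x⁻¹, H.inv_mem hx, by simp [hx1], by simp [fD_inv, hx1]⟩ }
  let Δ := lin (fun g => fD (s g))
  have key : ∀ (x : LR l) (j : κ), Δ x + x • fD (y j) - Δ (x * tm (fE (y j))) ∈ N := by
    intro x j
    induction x using AddMonoidAlgebra.induction_linear with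
    | zero => simp
    | add f g hf hg =>
      have := N.add_mem hf hg
      convert this using 1
      rw [map_add, add_smul, add_mul, map_add]
      abel
    | single g a =>
      have h1 : (AddMonoidAlgebra.single g a : LR l) * tm (fE (y j)) =
          .single (g + fE (y j)) a := by
        simp [tm, AddMonoidAlgebra.single_mul_single]
      have h2 : (AddMonoidAlgebra.single g a : LR l) • fD (y j) = a • (tm g • fD (y j)) := by
        rw [LR_single_eq, mul_smul, Int.cast_smul_eq_zsmul]
      rw [h1, h2]
      simp only [Δ, lin_single]
      rw [← smul_add, ← smul_sub]
      refine N.zsmul_mem ?_ a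
      refine ⟨s g * y j * (s (g + fE (y j)))⁻¹,
        H.mul_mem (H.mul_mem (hs _) (Subgroup.subset_closure ⟨j, rfl⟩)) (H.inv_mem (hs _)), ?_, ?_⟩
      · simp [hsE]
      · rw [fD_mul_inv _ _ (by simp [hsE]), fD_mul, hsE]
  have hsum := N.sum_mem (t := Finset.univ) (fun j _ => key (z j) j)
  have h3 : ∑ j, (Δ (z j) + z j • fD (y j) - Δ (z j * tm (fE (y j)))) = ∑ j, z j • fD (y j) := by
    have h4 : ∑ j, (Δ (z j * tm (fE (y j))) - Δ (z j)) = 0 := by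
      rw [← map_zero Δ, ← hz, map_sum]
      exact Finset.sum_congr rfl fun j _ => by rw [mul_sub, map_sub, mul_one]
    have h5 : ∀ j, (Δ (z j) + z j • fD (y j) - Δ (z j * tm (fE (y j)))) =
        z j • fD (y j) - (Δ (z j * tm (fE (y j))) - Δ (z j)) := by
      intro j; abel
    simp only [h5]
    rw [Finset.sum_sub_distrib, h4, sub_zero]
  rw [h3] at hsum
  exact hsum

theorem fE_surj (v : Fin l → ℤ) : ∃ x ∈ Subgroup.closure (Set.range (FreeGroup.of : Fin l → _)),
    fE x = v := by
  refine fE_surj_of _ (fun v => ?_) v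
  simpa using closure_single l v

theorem fD_surj (w : Fin l → LR l) (b : Fin l → ℤ) (h : w ⬝ᵥ fv l = tm b - 1) :
    ∃ x, fD x = w := by
  obtain ⟨y0, -, hy0⟩ := fE_surj b
  have hz : (w - fD y0) ⬝ᵥ fv l = 0 := by
    rw [sub_dotProduct, h, fox, hy0, sub_self]
  obtain ⟨x, -, hx, hx2⟩ := lemmaK FreeGroup.of fE_surj (w - fD y0) (by
    simpa [dotProduct, fv] using hz)
  refine ⟨x * y0, ?_⟩
  rw [fD_mul, hx, hx2]
  ext i
  simp [Finset.sum_apply, Pi.single_apply]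

theorem mem_comm_of_fE (x : FreeGroup (Fin l)) (h : fE x = 0) : x ∈ derivedSeries (FreeGroup (Fin l)) 1 := by
  have key : ∀ x : FreeGroup (Fin l), (Abelianization.of x) =
      ∏ i, (Abelianization.of (FreeGroup.of i)) ^ (fE x i) := by
    intro x
    induction x using FreeGroup.induction_on with
    | C1 => simp
    | of i => 
      change Abelianization.of (FreeGroup.of i) = ∏ j, (Abelianization.of (FreeGroup.of j)) ^ (fE (FreeGroup.of i) j)
      rw [Finset.prod_eq_single i]
      · simp
      · intro j _ hj; simp [hj]
      · simp
    | inv_of i hi =>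
      change Abelianization.of (FreeGroup.of i)⁻¹ = ∏ j, (Abelianization.of (FreeGroup.of j)) ^ (fE (FreeGroup.of i)⁻¹ j)
      have hi : Abelianization.of (FreeGroup.of i) = ∏ j, (Abelianization.of (FreeGroup.of j)) ^ (fE (FreeGroup.of i) j) := hi
      rw [map_inv, hi]
      simp
    | mul x y hx hy =>
      rw [map_mul, hx, hy, ← Finset.prod_mul_distrib]
      exact Finset.prod_congr rfl fun i _ => by rw [fE_mul, Pi.add_apply, _root_.zpow_add]
  have := key x
  rw [h] at this
  rw [derivedSeries_one]
  have h2 : Abelianization.of x = 1 := by simpa using this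
  rwa [← MonoidHom.mem_ker, Abelianization.ker_of] at h2

theorem magnus_inj (c : FreeGroup (Fin l)) (hE : fE c = 0) (hD : fD c = 0) :
    c ∈ derivedSeries (FreeGroup (Fin l)) 2 := by
  choose s _ hsE using fE_surj (l := l)
  let K := derivedSeries (FreeGroup (Fin l)) 1
  let br : (Fin l → ℤ) → FreeGroup (Fin l) → K := fun g x =>
    ⟨s g * x * (s (g + fE x))⁻¹, mem_comm_of_fE _ (by simp [hsE])⟩
  let cl : K → Additive (Abelianization K) := fun k => Additive.ofMul (Abelianization.of k)
  have cl_mul : ∀ a b, cl (a * b) = cl a + cl b := fun a b => by simp [cl]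
  have cl_one : cl 1 = 0 := by simp [cl]
  let Θ : (Fin l → LR l) →+ Additive (Abelianization K) :=
    ∑ i, (lin (fun g => cl (br g (FreeGroup.of i)))).comp (Pi.evalAddMonoidHom (fun _ : Fin l => LR l) i)
  have hΘ : ∀ v, Θ v = ∑ i, lin (fun g => cl (br g (FreeGroup.of i))) (v i) := by
    intro v; simp [Θ]
  have br_inv : ∀ g x, br g x⁻¹ * br (g - fE x) x = 1 := by
    intro g x
    ext1
    simp only [br, Subgroup.coe_mul, Subgroup.coe_one, fE_inv, sub_add_cancel, ← sub_eq_add_neg]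
    group
  have br_mul : ∀ g x y, br g (x * y) = br g x * br (g + fE x) y := by
    intro g x y
    ext1
    simp only [br, Subgroup.coe_mul, fE_mul, add_assoc]
    group
  have key : ∀ x g, Θ (tm g • fD x) = cl (br g x) := by
    intro x
    have hinv : ∀ x, (∀ g, Θ (tm g • fD x) = cl (br g x)) →
        ∀ g, Θ (tm g • fD x⁻¹) = cl (br g x⁻¹) := by
      intro x hx g
      have h1 : tm g • fD x⁻¹ = -(tm (g - fE x) • fD x) := by
        rw [fD_inv, smul_neg, smul_smul, ← tm_add, ← sub_eq_add_neg]
      rw [h1, map_neg, hx]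
      have := cl_mul (br g x⁻¹) (br (g - fE x) x)
      rw [br_inv, cl_one] at this
      exact (eq_neg_of_add_eq_zero_left this.symm).symm
    have hof : ∀ i g, Θ (tm g • fD (FreeGroup.of i)) = cl (br g (FreeGroup.of i)) := by
      intro i g
      rw [hΘ, Finset.sum_eq_single i]
      · simp [lin_tm]
      · intro j _ hj; simp [hj]
      · simp
    induction x using FreeGroup.induction_on with
    | C1 =>
      intro g
      have : br g 1 = 1 := by ext1; simp [br]
      rw [this, cl_one]; simp
    | of i => exact hof i
    | inv_of i _ => exact hinv _ (hof i)
    | mul x y hx hy =>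
      intro g
      rw [fD_mul, smul_add, smul_smul, ← tm_add, map_add, hx, hy, br_mul, cl_mul]
  have h0 := key c 0
  rw [hD, smul_zero, map_zero] at h0
  have h1 : Abelianization.of (br 0 c) = 1 := h0.symm
  rw [← MonoidHom.mem_ker, Abelianization.ker_of] at h1
  have h2 : (br 0 c : FreeGroup (Fin l)) ∈ derivedSeries (FreeGroup (Fin l)) 2 := by
    have h3 := Subgroup.mem_map_of_mem K.subtype h1
    rw [commutator_def, Subgroup.map_commutator] at h3
    rw [derivedSeries_succ]
    refine Subgroup.commutator_mono ?_ ?_ h3 <;>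
    · rintro _ ⟨x, -, rfl⟩
      exact x.2
  have h4 := (derivedSeries_normal (FreeGroup (Fin l)) 2).conj_mem _ h2 (s 0)⁻¹
  convert h4 using 1
  simp only [br, hE, add_zero]
  group

theorem generate {κ : Type*} [Fintype κ] [DecidableEq κ] (y : κ → FreeGroup (Fin l))
    (W' : Matrix (Fin l) κ (LR l)) (hW : W' * (Matrix.of fun c => fD (y c)) = 1) 
    (x : FreeGroup (Fin l)) :
    x ∈ Subgroup.closure (Set.range y) ⊔ derivedSeries (FreeGroup (Fin l)) 2 := by
  set W : Matrix κ (Fin l) (LR l) := Matrix.of fun c => fD (y c) with hWdef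
  have hsurj := fE_surj_of y (by
    intro v
    let B : Matrix κ (Fin l) ℤ := W.map (aug l)
    let Bi : Matrix (Fin l) κ ℤ := W'.map (aug l)
    have hB2 : Bi * B = 1 := by
      have := congrArg (fun M : Matrix _ _ (LR l) => M.map (aug l)) hW
      simpa [B, Bi, Matrix.map_mul] using this
    have hB : ∀ c, B c = fE (y c) := fun c => funext fun j => aug_row _ _ (fox (y c)) j
    have : v = ∑ c, (v ᵥ* Bi) c • fE (y c) := by
      have h1 : v = (v ᵥ* Bi) ᵥ* B := by rw [vecMul_vecMul, hB2, vecMul_one]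
      conv_lhs => rw [h1]
      generalize v ᵥ* Bi = u
      ext j
      simp [vecMul, dotProduct, ← hB]
    rw [this]
    exact AddSubgroup.sum_mem _ fun i _ =>
      AddSubgroup.zsmul_mem _ (AddSubgroup.subset_closure (Set.mem_range_self i)) _)
  obtain ⟨h, hh, hhE⟩ := hsurj (fE x)
  let c := x * h⁻¹
  have hc : fE c = 0 := by simp [c, hhE]
  have hzW : (fD c ᵥ* W') ᵥ* W = fD c := by rw [vecMul_vecMul, hW, vecMul_one]
  obtain ⟨h', hh', hE', hD'⟩ := lemmaK y hsurj (fD c ᵥ* W') (by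
    have h1 : ∀ j, tm (fE (y j)) - 1 = (W *ᵥ fv l) j := fun j => (fox (y j)).symm
    simp only [h1]
    change (fD c ᵥ* W') ⬝ᵥ (W *ᵥ fv l) = 0
    rw [dotProduct_mulVec, hzW, fox, hc]
    simp)
  have hD2 : fD h' = fD c := by
    rw [hD']
    conv_rhs => rw [← hzW]
    ext j
    simp [vecMul, dotProduct, hWdef, Finset.sum_apply]
  have hin : c * h'⁻¹ ∈ derivedSeries (FreeGroup (Fin l)) 2 := by
    refine magnus_inj _ (by simp [hc, hE']) ?_
    rw [fD_mul_inv _ _ (by rw [hc, hE']), hD2, sub_self]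
  have : x = (c * h'⁻¹) * (h' * h) := by simp only [c]; group
  rw [this]
  exact Subgroup.mul_mem _ (Subgroup.mem_sup_right hin)
    (Subgroup.mem_sup_left (Subgroup.mul_mem _ hh' hh))

end FM

set_option linter.unusedSectionVars false

namespace FM
open Matrix

/-- Weights. -/
def qw (r l : ℕ) : Fin r → Fin l → ℤ := fun i => if h : (i : ℕ) < l then Pi.single ⟨i, h⟩ 1 else 0

/-- Extension by zero. -/
noncomputable def ext0 {r l : ℕ} (v : Fin l → LR l) : Fin r → LR l :=
  fun c => if h : (c : ℕ) < l then v ⟨c, h⟩ else 0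

theorem mag_map {r l : ℕ} (hlr : l ≤ r) (y : FreeGroup (Fin l)) :
    mag (qw r l) (FreeGroup.map (Fin.castLE hlr) y) = ⟨ext0 (fD y), fE y⟩ := by
  have hof : ∀ i : Fin l, mag (qw r l) (FreeGroup.map (Fin.castLE hlr) (FreeGroup.of i)) =
      ⟨ext0 (fD (FreeGroup.of i)), fE (FreeGroup.of i)⟩ := by
    intro i
    ext1
    · ext1 c
      simp only [FreeGroup.map.of, mag_of, ext0, fD_of]
      by_cases h : (c : ℕ) < l
      · simp [h, Pi.single_apply, Fin.ext_iff]
      · have : c ≠ Fin.castLE hlr i := by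
          rintro rfl; exact h i.2
        simp [h, this]
    · simp [qw]
  induction y using FreeGroup.induction_on with
  | C1 =>
    ext1
    · ext1 c; simp [ext0]
    · simp
  | of i => exact hof i
  | inv_of i _ =>
    change mag (qw r l) (FreeGroup.map (Fin.castLE hlr) (FreeGroup.of i)⁻¹) =
      ⟨ext0 (fD (FreeGroup.of i)⁻¹), fE (FreeGroup.of i)⁻¹⟩
    rw [map_inv, map_inv, hof]
    ext1
    · ext1 c
      simp only [Mag.inv_vec, ext0, fD_inv]
      by_cases h : (c : ℕ) < l <;> simp [h, ext0]
    · simp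
  | mul x y hx hy =>
    rw [map_mul, map_mul, hx, hy]
    ext1
    · ext1 c
      simp only [Mag.mul_vec, fD_mul]
      by_cases h : (c : ℕ) < l <;> simp [h, ext0]
    · simp

theorem unimod_rows {r l : ℕ} (hlr : l ≤ r) (T : Finset (MetabelianQuot (FreeGroup (Fin r))))
    (hT : Subgroup.closure (T : Set (MetabelianQuot (FreeGroup (Fin r)))) = ⊤) (hc : T.card = r)
    {k : ℕ} (y : Fin k → FreeGroup (Fin l))
    (hy : ∀ i, (QuotientGroup.mk (FreeGroup.map (Fin.castLE hlr) (y i)) :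
      MetabelianQuot (FreeGroup (Fin r))) ∈ T)
    (hinj : Function.Injective fun i => (QuotientGroup.mk (FreeGroup.map (Fin.castLE hlr) (y i)) :
      MetabelianQuot (FreeGroup (Fin r)))) :
    ∃ Y : Matrix (Fin l) (Fin k) (LR l), (Matrix.of fun i => fD (y i)) * Y = 1 := by
  let φ : MetabelianQuot (FreeGroup (Fin r)) →* Mag l r :=
    QuotientGroup.lift _ (mag (qw r l)) (fun c hc => mag_of_mem_derived _ c hc)
  have hφ : ∀ x, φ (QuotientGroup.mk x) = mag (qw r l) x := fun x => rfl
  let e : T ≃ Fin r := T.equivFinOfCardEq hc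
  let P : Matrix (Fin r) (Fin r) (LR l) := Matrix.of fun i => (φ (e.symm i)).vec
  let N : Submodule (LR l) (Fin r → LR l) := Submodule.span (LR l) (Set.range P)
  have hN : ∀ g, (φ g).vec ∈ N := by
    intro g
    have hg : g ∈ Subgroup.closure (T : Set (MetabelianQuot (FreeGroup (Fin r)))) := by
      rw [hT]; trivial
    induction hg using Subgroup.closure_induction with
    | mem x hx =>
      refine Submodule.subset_span ⟨e ⟨x, hx⟩, ?_⟩
      have : (φ (e.symm (e ⟨x, hx⟩))).vec = (φ x).vec := by rw [Equiv.symm_apply_apply]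
      exact this
    | one => simp
    | mul x y _ _ hx hy =>
      rw [map_mul, Mag.mul_vec]
      exact N.add_mem hx (N.smul_mem _ hy)
    | inv x _ hx =>
      rw [map_inv, Mag.inv_vec]
      exact N.neg_mem (N.smul_mem _ hx)
  have hQ : ∀ i, ∃ c : Fin r → LR l, ∑ j, c j • P j = Pi.single i 1 := by
    intro i
    have := hN (QuotientGroup.mk (FreeGroup.of i))
    rw [hφ, mag_of] at this
    exact (Submodule.mem_span_range_iff_exists_fun _).1 this
  choose Q hQ using hQ
  have hQP : (Matrix.of Q) * P = 1 := by
    refine Matrix.ext fun i j => ?_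
    have := congrFun (hQ i) j
    rw [mul_apply]
    simpa [Finset.sum_apply, Matrix.one_apply, Pi.single_apply, eq_comm] using this
  have hPQ : P * (Matrix.of Q) = 1 := mul_eq_one_comm.1 hQP
  let τ : Fin k → Fin r := fun i => e ⟨_, hy i⟩
  have hτ : Function.Injective τ := by
    intro i j hij
    have := e.injective hij
    exact hinj (congrArg Subtype.val this)
  refine ⟨Matrix.of fun j i => Q (Fin.castLE hlr j) (τ i), ?_⟩
  refine Matrix.ext fun i j => ?_
  have h1 := congrFun (congrFun hPQ (τ i)) (τ j)
  rw [mul_apply] at h1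
  have h2 : (1 : Matrix (Fin k) (Fin k) (LR l)) i j = (1 : Matrix (Fin r) (Fin r) (LR l)) (τ i) (τ j) := by
    simp [Matrix.one_apply, hτ.eq_iff]
  rw [h2, ← h1, mul_apply]
  have h3 : P (τ i) = ext0 (fD (y i)) := by
    have h4 : P (τ i) = (φ (e.symm (τ i))).vec := rfl
    rw [h4]
    simp only [τ, Equiv.symm_apply_apply]
    rw [hφ, mag_map]
  rw [h3]
  refine Fintype.sum_of_injective (Fin.castLE hlr) (Fin.castLE_injective hlr) _ _ ?_ ?_
  · intro c hc
    have : ¬ (c : ℕ) < l := by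
      intro h; exact hc ⟨⟨c, h⟩, rfl⟩
    simp [ext0, this]
  · intro c
    simp [ext0]

theorem extend {l k : ℕ} (y : Fin k → FreeGroup (Fin l)) (Y : Matrix (Fin l) (Fin k) (LR l))
    (hY : (Matrix.of fun i => fD (y i)) * Y = 1) :
    ∃ (n : ℕ) (y' : Fin k ⊕ Fin n → FreeGroup (Fin l)), k + n = l ∧
      (∀ i, y' (Sum.inl i) = y i) ∧ (Function.Injective fun c => fD (y' c)) ∧
      ∀ x, x ∈ Subgroup.closure (Set.range y') ⊔ derivedSeries (FreeGroup (Fin l)) 2 := by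
  obtain ⟨n, W, W', b', h1, h2, h3, h4⟩ := completion l k _ Y hY (fun i => fE (y i))
    (fun i => fox (y i))
  choose z hz using fun j : Fin n => fD_surj _ _ (h4 (Sum.inr j))
  let y' : Fin k ⊕ Fin n → FreeGroup (Fin l) := Sum.elim y z
  have hW : W = Matrix.of fun c => fD (y' c) := by
    funext c
    rcases c with i | j
    · exact h3 i
    · exact (hz j).symm
  refine ⟨n, y', ?_, fun i => rfl, ?_, ?_⟩
  · have := Matrix.square_of_invertible W W' h1 h2
    simpa using this
  · intro c d hcd
    have hcd : W c = W d := by rw [hW]; exact hcd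
    by_contra hne
    have e1 := congrFun (congrFun h1 c) c
    have e2 := congrFun (congrFun h1 d) c
    rw [mul_apply, hcd, ← mul_apply, e2, Matrix.one_apply_ne (Ne.symm hne), Matrix.one_apply_eq] at e1
    exact zero_ne_one e1
  · rw [hW] at h2
    exact generate y' W' h2

end FM

open FM

theorem stmt5 (r l k : ℕ) (hr : 2 ≤ r) (hl : 1 ≤ l) (hlr : l ≤ r - 1)
    (x : Fin k → FreeGroup (Fin r)) (hx : ∀ i, x i ∈ hatSubgroup r l)
    (hprim : ∃ T : Finset (MetabelianQuot (FreeGroup (Fin r))),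
      (∀ i, (QuotientGroup.mk (x i) : MetabelianQuot (FreeGroup (Fin r))) ∈ T) ∧
        Subgroup.closure (T : Set (MetabelianQuot (FreeGroup (Fin r)))) = ⊤ ∧ T.card = r) :
    ∃ T : Finset (MetabelianQuot (hatSubgroup r l)),
      (∀ i, (QuotientGroup.mk (⟨x i, hx i⟩ : hatSubgroup r l) :
          MetabelianQuot (hatSubgroup r l)) ∈ T) ∧
        Subgroup.closure (T : Set (MetabelianQuot (hatSubgroup r l))) = ⊤ ∧ T.card = l := by
  classical
  obtain ⟨T, hxT, hT, hTc⟩ := hprim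
  have hlr' : l ≤ r := by omega
  let j : FreeGroup (Fin l) →* FreeGroup (Fin r) := FreeGroup.map (Fin.castLE hlr')
  have hjr : hatSubgroup r l = j.range := by
    rw [MonoidHom.range_eq_map, ← FreeGroup.closure_range_of, MonoidHom.map_closure, hatSubgroup]
    congr 1
    ext g
    constructor
    · rintro ⟨i, hi, rfl⟩
      exact ⟨FreeGroup.of ⟨i, hi⟩, ⟨_, rfl⟩, by simp [j]⟩
    · rintro ⟨_, ⟨i, rfl⟩, rfl⟩
      exact ⟨Fin.castLE hlr' i, i.2, by simp [j]⟩
  let ret : FreeGroup (Fin r) →* FreeGroup (Fin l) :=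
    FreeGroup.lift fun i => if h : (i : ℕ) < l then FreeGroup.of ⟨i, h⟩ else 1
  have hret : ∀ y, ret (j y) = y := by
    intro y
    have : ret.comp j = MonoidHom.id _ := by
      ext i; simp [ret, j]
    exact DFunLike.congr_fun this y
  let j' : FreeGroup (Fin l) →* hatSubgroup r l := j.codRestrict _ (fun y => by rw [hjr]; exact ⟨y, rfl⟩)
  have hj's : Function.Surjective j' := by
    rintro ⟨g, hg⟩
    rw [hjr] at hg
    obtain ⟨y, rfl⟩ := hg
    exact ⟨y, rfl⟩
  have hy : ∀ i, ∃ y, j y = x i := by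
    intro i
    have := hx i
    rw [hjr] at this
    exact this
  choose y hy using hy
  -- choose distinct representatives
  let S : Finset (MetabelianQuot (FreeGroup (Fin r))) :=
    Finset.univ.image fun i => (QuotientGroup.mk (x i) : MetabelianQuot (FreeGroup (Fin r)))
  let eS := S.equivFin
  have hs : ∀ a : Fin S.card, ∃ i, (QuotientGroup.mk (x i) : MetabelianQuot (FreeGroup (Fin r))) = eS.symm a := by
    intro a
    have := (eS.symm a).2
    obtain ⟨i, -, hi⟩ := Finset.mem_image.1 this
    exact ⟨i, hi⟩
  choose s hs using hs
  have hsi : ∀ i, ∃ a, (QuotientGroup.mk (x i) : MetabelianQuot (FreeGroup (Fin r))) = QuotientGroup.mk (x (s a)) := by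
    intro i
    have hi : (QuotientGroup.mk (x i) : MetabelianQuot (FreeGroup (Fin r))) ∈ S :=
      Finset.mem_image_of_mem _ (Finset.mem_univ i)
    refine ⟨eS ⟨_, hi⟩, ?_⟩
    rw [hs]; simp
  obtain ⟨Y, hY⟩ := unimod_rows hlr' T hT hTc (fun a => y (s a))
    (fun a => by
      have := hxT (s a)
      rw [← hy] at this
      exact this)
    (by
      intro a b hab
      have hab : (QuotientGroup.mk (j (y (s a))) : MetabelianQuot (FreeGroup (Fin r))) =
        QuotientGroup.mk (j (y (s b))) := hab
      rw [hy, hy, hs, hs] at hab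
      exact eS.symm.injective (Subtype.ext hab))
  obtain ⟨n, y', hkn, hy', hinj, hgen⟩ := extend _ Y hY
  let t : Fin S.card ⊕ Fin n → MetabelianQuot (hatSubgroup r l) := fun c => QuotientGroup.mk (j' (y' c))
  have hder : ∀ u v : hatSubgroup r l, (QuotientGroup.mk u : MetabelianQuot (hatSubgroup r l)) = QuotientGroup.mk v →
      ret u⁻¹ * ret v ∈ derivedSeries (FreeGroup (Fin l)) 2 := by
    intro u v huv
    rw [QuotientGroup.eq] at huv
    have := map_derivedSeries_le_derivedSeries (ret.comp (hatSubgroup r l).subtype) 2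
      (Subgroup.mem_map_of_mem _ huv)
    simpa using this
  have htinj : Function.Injective t := by
    intro c d hcd
    have h1 := hder _ _ hcd
    have h2 : ∀ y, ret (j' y : FreeGroup (Fin r)) = y := hret
    rw [map_inv, h2, h2] at h1
    apply hinj
    have h3 := mag_of_mem_derived (mag (fun i : Fin l => Pi.single i 1)) _ h1
    rw [map_mul, map_inv, inv_mul_eq_one] at h3
    exact congrArg Mag.vec h3
  refine ⟨Finset.univ.image t, ?_, ?_, ?_⟩
  · intro i
    obtain ⟨a, ha⟩ := hsi i
    rw [Finset.mem_image]
    refine ⟨Sum.inl a, Finset.mem_univ _, ?_⟩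
    simp only [t, hy']
    rw [QuotientGroup.eq] at ha ⊢
    have h1 := map_derivedSeries_le_derivedSeries ret 2 (Subgroup.mem_map_of_mem _ ha)
    rw [map_mul, map_inv, ← hy, ← hy, hret, hret] at h1
    have h2 := map_derivedSeries_le_derivedSeries j' 2 (Subgroup.mem_map_of_mem _ (Subgroup.inv_mem _ h1))
    convert h2 using 1
    have h3 : (⟨x i, hx i⟩ : hatSubgroup r l) = j' (y i) := Subtype.ext (hy i).symm
    rw [h3]
    simp
  · rw [Finset.coe_image, Finset.coe_univ, Set.image_univ]
    rw [eq_top_iff]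
    rintro g -
    obtain ⟨u, rfl⟩ := QuotientGroup.mk_surjective g
    obtain ⟨v, rfl⟩ := hj's u
    have hle : Subgroup.closure (Set.range y') ⊔ derivedSeries (FreeGroup (Fin l)) 2 ≤
        (Subgroup.closure (Set.range t)).comap ((QuotientGroup.mk' _).comp j') := by
      refine sup_le ?_ ?_
      · rw [Subgroup.closure_le]
        rintro _ ⟨c, rfl⟩
        exact Subgroup.subset_closure ⟨c, rfl⟩
      · intro c hc
        have := map_derivedSeries_le_derivedSeries j' 2 (Subgroup.mem_map_of_mem _ hc)
        have h1 : (QuotientGroup.mk (j' c) : MetabelianQuot (hatSubgroup r l)) = 1 :=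
          (QuotientGroup.eq_one_iff _).2 this
        rw [Subgroup.mem_comap]
        change (QuotientGroup.mk (j' c) : MetabelianQuot (hatSubgroup r l)) ∈ _
        rw [h1]
        exact Subgroup.one_mem _
    exact hle (hgen v)
  · rw [Finset.card_image_of_injective _ htinj]
    simpa using hkn
end

section
/- Let G be a group and H ≤ G a subgroup, and consider the integral group ring ℤ[H] as a subring of ℤ[G]. Let J be a k × r matrix with entries in ℤ[H]. If there exists an r × k matrix P with entries in ℤ[G] such that JP = I_k (the k × k identity matrix over ℤ[G]), then there exists an r × k matrix R with entries in ℤ[H] such that JR = I_k. In particular, a matrix over ℤ[H] that is right invertible over ℤ[G] is right invertible over ℤ[H]. -/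
/-- The ring embedding `ℤ[H] → ℤ[G]` induced by the inclusion of a subgroup `H ≤ G`. -/
noncomputable def groupRingIncl {G : Type*} [Group G] (H : Subgroup G) :
    MonoidAlgebra ℤ H →+* MonoidAlgebra ℤ G :=
  MonoidAlgebra.mapDomainRingHom ℤ H.subtype

/-- The projection `ℤ[G] → ℤ[H]` restricting the support to `H`. -/
noncomputable def groupRingProj {G : Type*} [Group G] (H : Subgroup G) :
    MonoidAlgebra ℤ G →+ MonoidAlgebra ℤ H :=
  MonoidAlgebra.comapDomainAddMonoidHom (R := ℤ) (H.subtype : H → G) H.subtype_injective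

theorem coeff_groupRingProj {G : Type*} [Group G] (H : Subgroup G) (p : MonoidAlgebra ℤ G)
    (h : H) : (groupRingProj H p).coeff h = p.coeff (h : G) := rfl

theorem groupRingProj_mul {G : Type*} [Group G] (H : Subgroup G) (a : MonoidAlgebra ℤ H)
    (p : MonoidAlgebra ℤ G) :
    groupRingProj H (groupRingIncl H a * p) = a * groupRingProj H p := by
  induction a using MonoidAlgebra.induction_linear with
  | zero => simp
  | add a b ha hb => rw [map_add, add_mul, map_add, ha, hb, add_mul]
  | single h n =>
    ext x
    simp [groupRingIncl, coeff_groupRingProj]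

theorem groupRingProj_one {G : Type*} [Group G] (H : Subgroup G) :
    groupRingProj H 1 = 1 := by
  classical
  ext x
  simp [coeff_groupRingProj, MonoidAlgebra.one_def, Finsupp.single_apply, eq_comm]

theorem stmt8 {G : Type*} [Group G] (H : Subgroup G) (k r : ℕ)
    (J : Matrix (Fin k) (Fin r) (MonoidAlgebra ℤ H))
    (hP : ∃ P : Matrix (Fin r) (Fin k) (MonoidAlgebra ℤ G),
      (J.map (groupRingIncl H)) * P = 1) :
    ∃ R : Matrix (Fin r) (Fin k) (MonoidAlgebra ℤ H), J * R = 1 := by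
  obtain ⟨P, hP⟩ := hP
  refine ⟨P.map (groupRingProj H), ?_⟩
  refine Matrix.ext fun i j => ?_
  have h := congrArg (groupRingProj H) (congrFun (congrFun hP i) j)
  rw [Matrix.mul_apply, map_sum] at h
  simp only [Matrix.map_apply, groupRingProj_mul] at h
  rw [Matrix.mul_apply]
  simp only [Matrix.map_apply]
  rw [h, Matrix.one_apply, Matrix.one_apply]
  split_ifs
  · exact groupRingProj_one H
  · exact map_zero _
end
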